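/- arXiv:1612.09427 — 3 statements merged into one kernel-verified Lean document; each statement's English description precedes it below -/
import Mathlib

section
/- Let d ≥ 3, let F ≤ Sym({1,…,d}) be primitive but not cyclic of prime order, and set 𝔾 = U(F)⁺. Let a ∈ 𝔾 be a hyperbolic element and let (π, ℋ) be a unitary representation of 𝔾 without nonzero 𝔾-invariant vectors, where ℋ is a separable complex Hilbert space. Then for all vectors v, w ∈ ℋ, the matrix coefficients ⟨π(aⁿ)v, w⟩ tend to 0 as n → ∞. -/
open Filter Topology
open scoped InnerProductSpace

namespace TreeHM

variable {V : Type}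

/-! ### The automorphism group of a graph, with the topology of pointwise convergence -/

noncomputable instance autTopologicalSpace (T : SimpleGraph V) : TopologicalSpace (T ≃g T) :=
  letI : TopologicalSpace V := ⊥
  TopologicalSpace.induced (fun (g : T ≃g T) (x : V) => g x) inferInstance

/-- A graph automorphism preserves the combinatorial distance. -/
theorem iso_dist_le (T : SimpleGraph V) (g : T ≃g T) (u v : V) :
    T.dist (g u) (g v) ≤ T.dist u v := by
  by_cases h : T.Reachable u v
  · obtain ⟨p, hp⟩ := h.exists_walk_length_eq_dist
    calc T.dist (g u) (g v) ≤ (p.map g.toHom).length := SimpleGraph.dist_le _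
      _ = p.length := SimpleGraph.Walk.length_map _ _
      _ = T.dist u v := hp
  · rw [SimpleGraph.dist_eq_zero_of_not_reachable h,
      SimpleGraph.dist_eq_zero_of_not_reachable]
    intro hr
    have := hr.map g.symm.toHom
    exact h (by simpa using this)

theorem iso_dist_eq (T : SimpleGraph V) (g : T ≃g T) (u v : V) :
    T.dist (g u) (g v) = T.dist u v := by
  refine le_antisymm (iso_dist_le T g u v) ?_
  have := iso_dist_le T g⁻¹ (g u) (g v)
  simpa using this

/-- The tree `T` is locally finite. -/
def LocFin (T : SimpleGraph V) : Prop := ∀ x : V, (T.neighborSet x).Finite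

/-- The graph `T` is `d`-regular: every vertex has exactly `d` neighbours. -/
def Regular (T : SimpleGraph V) (d : ℕ) : Prop := ∀ x : V, (T.neighborSet x).ncard = d

/-! ### Geodesic rays and ends -/

/-- A geodesic ray in a graph; for a tree, the ends `∂T` are the equivalence classes of
geodesic rays under the relation `RayEquiv` of sharing a common subray.  Throughout, an end
`ξ ∈ ∂T` is represented by a geodesic ray, and equality of ends is `RayEquiv`. -/
structure GeodRay (T : SimpleGraph V) : Type where
  seq : ℕ → V
  adj : ∀ n, T.Adj (seq n) (seq (n + 1))
  geodesic : ∀ m n, T.dist (seq m) (seq n) = Nat.dist m n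

/-- A bi-infinite geodesic line in a graph. -/
structure GeodLine (T : SimpleGraph V) : Type where
  seq : ℤ → V
  adj : ∀ n, T.Adj (seq n) (seq (n + 1))
  geodesic : ∀ m n, T.dist (seq m) (seq n) = (m - n).natAbs

/-- Two geodesic rays are equivalent (define the same end) iff they share a common subray. -/
def RayEquiv (T : SimpleGraph V) (r s : GeodRay T) : Prop :=
  ∃ k l : ℕ, ∀ n : ℕ, r.seq (k + n) = s.seq (l + n)

/-- The image of a geodesic ray under an automorphism. -/
def mapRay (T : SimpleGraph V) (g : T ≃g T) (r : GeodRay T) : GeodRay T where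
  seq := fun n => g (r.seq n)
  adj := fun n => g.map_adj_iff.mpr (r.adj n)
  geodesic := fun m n => by rw [iso_dist_eq]; exact r.geodesic m n

/-- `g` fixes the end represented by the ray `r`. -/
def FixesEnd (T : SimpleGraph V) (g : T ≃g T) (r : GeodRay T) : Prop :=
  RayEquiv T (mapRay T g r) r

/-- A sequence of vertices converges to the end represented by the geodesic ray `r`:
for every `m`, the vertex `r.seq m` eventually lies on the geodesic from `r.seq 0` to `y n`,
i.e. the common initial segment of `[r.seq 0, y n]` and the ray tends to infinity. -/
def TendstoEnd (T : SimpleGraph V) (y : ℕ → V) (r : GeodRay T) : Prop :=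
  ∀ m : ℕ, ∀ᶠ n in atTop, T.dist (r.seq 0) (y n) = m + T.dist (r.seq m) (y n)

/-! ### Translation length and hyperbolic automorphisms -/

/-- The translation length `|g| = min_x dist(x, g x)` of an automorphism. -/
noncomputable def transLen (T : SimpleGraph V) (g : T ≃g T) : ℕ :=
  sInf (Set.range fun x : V => T.dist x (g x))

/-- `g` is hyperbolic iff its translation length is positive. -/
def IsHyperbolic (T : SimpleGraph V) (g : T ≃g T) : Prop := 0 < transLen T g

/-- The set `Min(g)` of vertices realizing the translation length; for a hyperbolic
automorphism of a tree this is its translation axis. -/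
def MinSet (T : SimpleGraph V) (g : T ≃g T) : Set V :=
  {x : V | T.dist x (g x) = transLen T g}

/-- The ray `r` (based at the axis) represents the attracting end of `a`:
the orbit `a^n x` converges to this end. -/
def IsAttractingEnd (T : SimpleGraph V) (a : T ≃g T) (r : GeodRay T) : Prop :=
  TendstoEnd T (fun n : ℕ => (a ^ n) (r.seq 0)) r

/-! ### Half-trees and Tits' independence property -/

/-- The half-tree determined by an oriented edge `(a, b)` of a tree:  all vertices `y`
lying on the side of `a`, i.e. whose geodesic to `b` passes through `a`. -/
def EdgeSide (T : SimpleGraph V) (a b : V) : Set V :=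
  {y : V | T.dist b y = T.dist a y + 1}

/-- The half-tree emanating from the base vertex `r.seq 0` of a ray `r` and containing the
end of `r` in its boundary. -/
def RaySide (T : SimpleGraph V) (r : GeodRay T) : Set V :=
  {y : V | y = r.seq 0 ∨ T.dist (r.seq 0) y = 1 + T.dist (r.seq 1) y}

/-- Tits' independence property for a subgroup `G ≤ Aut(T)`:  for every edge `e = (a, b)`,
the pointwise stabilizer `G_e` decomposes as `G_{T₁} · G_{T₂}`, where `T₁, T₂` are the two
half-trees emanating from `e` and `G_{Tᵢ}` is the pointwise stabilizer of `Tᵢ`. -/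
def TitsIndep (T : SimpleGraph V) (G : Subgroup (T ≃g T)) : Prop :=
  ∀ a b : V, T.Adj a b → ∀ g ∈ G, g a = a → g b = b →
    ∃ g₁ ∈ G, ∃ g₂ ∈ G, g = g₁ * g₂ ∧
      (∀ y ∈ EdgeSide T a b, g₁ y = y) ∧ (∀ y ∈ EdgeSide T b a, g₂ y = y)

/-! ### Stabilizers and contraction groups -/

/-- The subgroup `G_ξ⁰ = {g ∈ G : g ξ = ξ and g fixes some vertex}`, as a subset of `G`. -/
def EndStab0 (T : SimpleGraph V) (G : Subgroup (T ≃g T)) (ξ : GeodRay T) : Set G :=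
  {g : G | FixesEnd T (g : T ≃g T) ξ ∧ ∃ x : V, (g : T ≃g T) x = x}

/-- The contraction group `U⁺_α` of a sequence `α` in `G`. -/
def ContrSeq {G : Type} [Group G] [TopologicalSpace G] (α : ℕ → G) : Set G :=
  {g : G | Tendsto (fun n : ℕ => (α n)⁻¹ * g * α n) atTop (𝓝 1)}

/-- The contraction group `U⁺_a = {g : a⁻ⁿ g aⁿ → 1}` of an element `a` of `G`. -/
def Upos {G : Type} [Group G] [TopologicalSpace G] (a : G) : Set G :=
  ContrSeq (fun n : ℕ => a ^ n)

/-- The contraction group `U⁻_a = {g : aⁿ g a⁻ⁿ → 1}` of an element `a` of `G`. -/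
def Uneg {G : Type} [Group G] [TopologicalSpace G] (a : G) : Set G :=
  ContrSeq (fun n : ℕ => (a ^ n)⁻¹)

/-! ### Unitary representations and the Howe–Moore property -/

/-- A (strongly continuous) unitary representation of a topological group `G` on a complex
inner product space `H`. -/
structure UnitaryRep (G : Type) [Group G] [TopologicalSpace G]
    (H : Type) [NormedAddCommGroup H] [InnerProductSpace ℂ H] where
  ρ : G →* (H ≃ₗᵢ[ℂ] H)
  strong_continuity : ∀ v : H, Continuous fun g : G => ρ g v

/-- The representation `π` has no nonzero `G`-invariant vector. -/
def NoInvariantVectors {G : Type} [Group G] [TopologicalSpace G]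
    {H : Type} [NormedAddCommGroup H] [InnerProductSpace ℂ H]
    (π : UnitaryRep G H) : Prop :=
  ∀ v : H, (∀ g : G, π.ρ g v = v) → v = 0

/-- The Howe–Moore property: every unitary representation without nonzero invariant vectors
has all its matrix coefficients vanishing at infinity. -/
def HasHoweMoore (G : Type) [Group G] [TopologicalSpace G] : Prop :=
  ∀ (H : Type) [NormedAddCommGroup H] [InnerProductSpace ℂ H] [CompleteSpace H]
    (π : UnitaryRep G H), NoInvariantVectors π →
      ∀ v w : H, Tendsto (fun g : G => ⟪π.ρ g v, w⟫_ℂ) (cocompact G) (𝓝 0)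

/-! ### Legal colorings and the universal groups of Burger–Mozes -/

/-- A legal coloring of a `d`-regular tree: a coloring of the (unoriented) edges by
`{1, …, d}` whose restriction to the star of each vertex is a bijection onto `{1, …, d}`.
The color of the edge `{x, y}` is recorded as `color x y` with `color x y = color y x`. -/
structure LegalColoring (T : SimpleGraph V) (d : ℕ) where
  color : V → V → Fin d
  symm : ∀ x y : V, T.Adj x y → color x y = color y x
  injOn : ∀ x : V, Set.InjOn (color x) (T.neighborSet x)
  surjOn : ∀ x : V, Set.SurjOn (color x) (T.neighborSet x) Set.univ

/-- Membership in the universal group `U(F)`: at every vertex `x` the local action of `g`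
on colors is given by an element of `F`. -/
def InUF {d : ℕ} (T : SimpleGraph V) (F : Subgroup (Equiv.Perm (Fin d)))
    (ι : LegalColoring T d) (g : T ≃g T) : Prop :=
  ∀ x : V, ∃ σ ∈ F, ∀ y : V, T.Adj x y → σ (ι.color x y) = ι.color (g x) (g y)

/-- The universal group `U(F)⁺`: the subgroup of `Aut(T)` generated by the elements of
`U(F)` fixing (pointwise) an edge of `T`. -/
def UFplus {d : ℕ} (T : SimpleGraph V) (F : Subgroup (Equiv.Perm (Fin d)))
    (ι : LegalColoring T d) : Subgroup (T ≃g T) :=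
  Subgroup.closure
    {g : T ≃g T | InUF T F ι g ∧ ∃ x y : V, T.Adj x y ∧ g x = x ∧ g y = y}

/-! ### Permutation group conditions -/

/-- `F` acts transitively on `{1, …, d}`. -/
def PermTransitive {d : ℕ} (F : Subgroup (Equiv.Perm (Fin d))) : Prop :=
  ∀ i j : Fin d, ∃ σ ∈ F, σ i = j

/-- `F` acts 2-transitively on `{1, …, d}`. -/
def PermTwoTransitive {d : ℕ} (F : Subgroup (Equiv.Perm (Fin d))) : Prop :=
  ∀ a b c e : Fin d, a ≠ b → c ≠ e → ∃ σ ∈ F, σ a = c ∧ σ b = e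

/-- `F` acts primitively on `{1, …, d}`: it is transitive and every block of the action
is trivial (a subsingleton or the whole set). -/
def PermPrimitive {d : ℕ} (F : Subgroup (Equiv.Perm (Fin d))) : Prop :=
  PermTransitive F ∧
    ∀ B : Set (Fin d),
      (∀ σ ∈ F, (σ : Equiv.Perm (Fin d)) '' B = B ∨
        Disjoint ((σ : Equiv.Perm (Fin d)) '' B) B) →
      B.Subsingleton ∨ B = Set.univ

/-- `F` is a cyclic group of prime order. -/
def CyclicOfPrimeOrder {d : ℕ} (F : Subgroup (Equiv.Perm (Fin d))) : Prop :=
  IsCyclic F ∧ (Nat.card F).Prime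

/-- `F` is generated by its point stabilizers `F_i = {σ ∈ F : σ i = i}`. -/
def GenByPointStabilizers {d : ℕ} (F : Subgroup (Equiv.Perm (Fin d))) : Prop :=
  F = Subgroup.closure {σ : Equiv.Perm (Fin d) | σ ∈ F ∧ ∃ i : Fin d, σ i = i}


/-! ### Basic tree lemmas -/

theorem parent_unique {T : SimpleGraph V} (hT : T.IsTree) (r : V) {w y z : V}
    (hy : T.Adj w y) (hz : T.Adj w z) (h1 : T.dist r y + 1 = T.dist r w)
    (h2 : T.dist r z + 1 = T.dist r w) : y = z := by
  obtain ⟨p, hp⟩ := (hT.connected r y).exists_walk_length_eq_dist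
  obtain ⟨q, hq⟩ := (hT.connected r z).exists_walk_length_eq_dist
  have hp' : (p.concat hy.symm).IsPath :=
    SimpleGraph.Walk.isPath_of_length_eq_dist _ (by rw [SimpleGraph.Walk.length_concat]; omega)
  have hq' : (q.concat hz.symm).IsPath :=
    SimpleGraph.Walk.isPath_of_length_eq_dist _ (by rw [SimpleGraph.Walk.length_concat]; omega)
  have := (hT.existsUnique_path r w).unique hp' hq'
  have h3 := congrArg SimpleGraph.Walk.penultimate this
  simpa using h3

theorem exists_parent {T : SimpleGraph V} (hT : T.IsTree) (r z : V) (h : z ≠ r) :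
    ∃ w, T.Adj z w ∧ T.dist r z = T.dist r w + 1 := by
  obtain ⟨p, hp⟩ := (hT.connected z r).exists_walk_length_eq_dist
  cases p with
  | nil => exact absurd rfl h
  | @cons _ w _ hadj p =>
    refine ⟨w, hadj, ?_⟩
    have h1 := SimpleGraph.dist_le p
    rw [SimpleGraph.Walk.length_cons] at hp
    rw [SimpleGraph.dist_comm] at h1 hp
    rcases hT.dist_eq_dist_add_one_of_adj r hadj with h2 | h2 <;> omega

theorem side_cases {T : SimpleGraph V} (hT : T.IsTree) {x y : V} (h : T.Adj x y) (z : V) :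
    z ∈ EdgeSide T x y ∨ z ∈ EdgeSide T y x := by
  have := hT.dist_eq_dist_add_one_of_adj z h
  simp only [EdgeSide, Set.mem_ofPred_eq]
  rw [SimpleGraph.dist_comm (u := x), SimpleGraph.dist_comm (u := y)]
  exact this.symm

theorem side_not {T : SimpleGraph V} {x y z : V} (h : z ∈ EdgeSide T x y) :
    z ∉ EdgeSide T y x := by
  simp only [EdgeSide, Set.mem_ofPred_eq] at *
  omega

theorem side_cross {T : SimpleGraph V} (hT : T.IsTree) {x y u v : V} (h : T.Adj x y)
    (huv : T.Adj u v) (hu : u ∈ EdgeSide T x y) (hv : v ∈ EdgeSide T y x) : u = x ∧ v = y := by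
  simp only [EdgeSide, Set.mem_ofPred_eq] at hu hv
  have h1 := hT.dist_eq_dist_add_one_of_adj x huv
  have h2 := hT.dist_eq_dist_add_one_of_adj y huv
  by_cases hux : u = x
  · subst hux
    refine ⟨rfl, ?_⟩
    rw [SimpleGraph.dist_self] at *
    have : T.dist y v = 0 := by omega
    exact ((hT.connected y v).dist_eq_zero_iff.mp this).symm
  · exfalso
    obtain ⟨u', hadj, hd⟩ := exists_parent hT x u hux
    have h3 := hT.dist_eq_dist_add_one_of_adj y hadj
    have h4 := hT.dist_eq_dist_add_one_of_adj u' h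
    rw [SimpleGraph.dist_comm (v := x), SimpleGraph.dist_comm (v := y)] at h4
    have : u' = v := parent_unique hT y hadj huv (by omega) (by omega)
    subst this
    omega

theorem exists_transport {T : SimpleGraph V} (hT : T.IsTree) {X : Type} (φ : V → V → X → X)
    (hφ : ∀ z w, T.Adj z w → ∀ t, φ w z (φ z w t) = t) (r : V) (x0 : X) :
    ∃ g : V → X, g r = x0 ∧ ∀ z w, T.Adj z w → g w = φ z w (g z) := by
  have hpar : ∀ z, ∃ w, z ≠ r → T.Adj z w ∧ T.dist r z = T.dist r w + 1 := by
    intro z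
    by_cases h : z = r
    · exact ⟨z, fun h' => absurd h h'⟩
    · obtain ⟨w, hw⟩ := exists_parent hT r z h
      exact ⟨w, fun _ => hw⟩
  choose par hpar using hpar
  let G : ℕ → V → X := fun n => Nat.rec (fun _ => x0) (fun _ f z => φ (par z) z (f (par z))) n
  have hG : ∀ n z, G (n + 1) z = φ (par z) z (G n (par z)) := fun n z => rfl
  have key : ∀ z w, T.Adj z w → T.dist r w = T.dist r z + 1 →
      G (T.dist r w) w = φ z w (G (T.dist r z) z) := by
    intro z w h hd
    have hw : w ≠ r := by
      rintro rfl
      rw [SimpleGraph.dist_self] at hd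
      omega
    obtain ⟨h1, h2⟩ := hpar w hw
    have : par w = z := parent_unique hT r h1 h.symm h2.symm hd.symm
    rw [hd, hG, this]
  refine ⟨fun z => G (T.dist r z) z, ?_, ?_⟩
  · simp [G]
  · intro z w h
    rcases hT.dist_eq_dist_add_one_of_adj r h with h1 | h1
    · have := key w z h.symm h1
      show G (T.dist r w) w = φ z w (G (T.dist r z) z)
      rw [this, hφ w z h.symm]
    · exact key z w h h1

theorem tree_induct {T : SimpleGraph V} (hT : T.IsTree) (P : V → Prop) (r : V) (hr : P r)
    (hs : ∀ x y, T.Adj x y → P x → P y) (z : V) : P z := by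
  obtain ⟨p⟩ := hT.connected r z
  induction p with
  | nil => exact hr
  | cons h p ih => exact ih (hs _ _ h hr)

theorem exists_rot {T : SimpleGraph V} (hT : T.IsTree) {d : ℕ} (ι : LegalColoring T d)
    (σ : Equiv.Perm (Fin d)) (r : V) :
    ∃ g : T ≃g T, g r = r ∧ ∀ z w, T.Adj z w → ι.color (g z) (g w) = σ (ι.color z w) := by
  have hstep : ∀ x c, ∃ y, T.Adj x y ∧ ι.color x y = c := by
    intro x c
    obtain ⟨y, hy, hc⟩ := ι.surjOn x (Set.mem_univ c)
    exact ⟨y, hy, hc⟩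
  choose step hadj hcol using hstep
  have hback : ∀ x c, step (step x c) c = x := by
    intro x c
    apply ι.injOn (step x c) (hadj _ _) (hadj _ _).symm
    rw [hcol, ι.symm _ _ (hadj x c).symm, hcol]
  have main : ∀ τ : Equiv.Perm (Fin d), ∃ g : V → V, g r = r ∧
      ∀ z w, T.Adj z w → g w = step (g z) (τ (ι.color z w)) := by
    intro τ
    refine exists_transport hT (fun z w t => step t (τ (ι.color z w))) ?_ r r
    intro z w h t
    show step (step t (τ (ι.color z w))) (τ (ι.color w z)) = t
    rw [ι.symm w z h.symm, hback]
  have hA : ∀ (τ : Equiv.Perm (Fin d)) (g : V → V),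
      (∀ z w, T.Adj z w → g w = step (g z) (τ (ι.color z w))) →
      ∀ z w, T.Adj z w → T.Adj (g z) (g w) ∧ ι.color (g z) (g w) = τ (ι.color z w) := by
    intro τ g hg z w h
    rw [hg z w h]
    exact ⟨hadj _ _, hcol _ _⟩
  have hinv : ∀ (τ τ' : Equiv.Perm (Fin d)) (g g' : V → V), (∀ c, τ' (τ c) = c) →
      g r = r → g' r = r →
      (∀ z w, T.Adj z w → g w = step (g z) (τ (ι.color z w))) →
      (∀ z w, T.Adj z w → g' w = step (g' z) (τ' (ι.color z w))) → ∀ z, g' (g z) = z := by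
    intro τ τ' g g' hτ h1 h2 hg hg'
    apply tree_induct hT (fun z => g' (g z) = z) r (by rw [h1, h2])
    intro x y hxy hx
    have h3 := hA τ g hg x y hxy
    have h4 := hA τ' g' hg' _ _ h3.1
    rw [hx] at h4
    apply ι.injOn x h4.1 hxy
    rw [h4.2, h3.2, hτ]
  obtain ⟨g, hg1, hg2⟩ := main σ
  obtain ⟨g', hg1', hg2'⟩ := main σ⁻¹
  have i1 := hinv σ σ⁻¹ g g' (by simp) hg1 hg1' hg2 hg2'
  have i2 := hinv σ⁻¹ σ g' g (by simp) hg1' hg1 hg2' hg2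
  refine ⟨⟨⟨g, g', i1, i2⟩, ?_⟩, hg1, fun z w h => (hA σ g hg2 z w h).2⟩
  intro z w
  constructor
  · intro h
    have := (hA _ g' hg2' _ _ h).1
    simpa [i1] using this
  · intro h
    exact (hA _ g hg2 _ _ h).1

theorem exists_split {T : SimpleGraph V} (hT : T.IsTree) {d : ℕ} (ι : LegalColoring T d)
    (F : Subgroup (Equiv.Perm (Fin d))) {x y : V} (h : T.Adj x y) (g : T ≃g T)
    (hg : InUF T F ι g) (hx : g x = x) (hy : g y = y) :
    ∃ g₁ : T ≃g T, InUF T F ι g₁ ∧ (∀ z ∈ EdgeSide T x y, g₁ z = z) ∧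
      (∀ z ∈ EdgeSide T y x, g₁ z = g z) := by
  classical
  have hxx : x ∈ EdgeSide T x y := by
    simp [EdgeSide, SimpleGraph.dist_eq_one_iff_adj, h.symm]
  let f : (T ≃g T) → V → V := fun k z => if z ∈ EdgeSide T x y then z else k z
  have f1 : ∀ k : T ≃g T, ∀ z, z ∈ EdgeSide T x y → f k z = z := fun k z hz => if_pos hz
  have f2 : ∀ k : T ≃g T, ∀ z, z ∈ EdgeSide T y x → f k z = k z :=
    fun k z hz => if_neg (side_not hz)
  have hside : ∀ k : T ≃g T, k x = x → k y = y → ∀ z, z ∈ EdgeSide T y x → k z ∈ EdgeSide T y x := by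
    intro k kx ky z hz
    simp only [EdgeSide, Set.mem_ofPred_eq] at *
    have e1 := iso_dist_eq T k x z
    have e2 := iso_dist_eq T k y z
    rw [kx] at e1
    rw [ky] at e2
    omega
  -- local agreement
  have floc1 : ∀ k : T ≃g T, k x = x → k y = y → ∀ z w, T.Adj z w → z ∈ EdgeSide T x y →
      f k w = w := by
    intro k kx ky z w hzw hz
    rcases side_cases hT h w with hw | hw
    · exact f1 k w hw
    · obtain ⟨-, rfl⟩ := side_cross hT h hzw hz hw
      rw [f2 k _ hw, ky]
  have floc2 : ∀ k : T ≃g T, k x = x → k y = y → ∀ z w, T.Adj z w → z ∈ EdgeSide T y x →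
      f k w = k w := by
    intro k kx ky z w hzw hz
    rcases side_cases hT h w with hw | hw
    · obtain ⟨rfl, -⟩ := side_cross hT h hzw.symm hw hz
      rw [f1 k _ hw, kx]
    · exact f2 k w hw
  have fadj : ∀ k : T ≃g T, k x = x → k y = y → ∀ z w, T.Adj z w → T.Adj (f k z) (f k w) := by
    intro k kx ky z w hzw
    rcases side_cases hT h z with hz | hz
    · rw [f1 k z hz, floc1 k kx ky z w hzw hz]
      exact hzw
    · rw [f2 k z hz, floc2 k kx ky z w hzw hz]
      exact k.map_adj_iff.mpr hzw
  have finv : ∀ k k' : T ≃g T, k x = x → k y = y → (∀ z, k' (k z) = z) → ∀ z, f k' (f k z) = z := by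
    intro k k' kx ky hk z
    rcases side_cases hT h z with hz | hz
    · rw [f1 k z hz, f1 k' z hz]
    · rw [f2 k z hz, f2 k' _ (hside k kx ky z hz), hk]
  have hx' : g.symm x = x := by rw [RelIso.symm_apply_eq, hx]
  have hy' : g.symm y = y := by rw [RelIso.symm_apply_eq, hy]
  have i1 := finv g g.symm hx hy (by simp)
  have i2 := finv g.symm g hx' hy' (by simp)
  refine ⟨⟨⟨f g, f g.symm, i1, i2⟩, ?_⟩, ?_, f1 g, f2 g⟩
  · intro z w
    constructor
    · intro hh
      have := fadj _ hx' hy' _ _ hh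
      simpa [i1] using this
    · intro hh
      exact fadj _ hx hy _ _ hh
  · intro z
    rcases side_cases hT h z with hz | hz
    · refine ⟨1, F.one_mem, fun w hzw => ?_⟩
      show ι.color z w = ι.color (f g z) (f g w)
      rw [f1 g z hz, floc1 g hx hy z w hzw hz]
    · obtain ⟨σ, hσ, hh⟩ := hg z
      refine ⟨σ, hσ, fun w hzw => ?_⟩
      show σ (ι.color z w) = ι.color (f g z) (f g w)
      rw [f2 g z hz, floc2 g hx hy z w hzw hz, hh w hzw]

theorem exists_tits {T : SimpleGraph V} (hT : T.IsTree) {d : ℕ} (ι : LegalColoring T d)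
    (F : Subgroup (Equiv.Perm (Fin d))) {x y : V} (h : T.Adj x y) (g : T ≃g T)
    (hg : InUF T F ι g) (hx : g x = x) (hy : g y = y) :
    ∃ g₁ g₂ : T ≃g T, InUF T F ι g₁ ∧ InUF T F ι g₂ ∧ g = g₁ * g₂ ∧
      (∀ z ∈ EdgeSide T x y, g₁ z = z) ∧ (∀ z ∈ EdgeSide T y x, g₂ z = z) ∧
      g₁ x = x ∧ g₁ y = y ∧ g₂ x = x ∧ g₂ y = y := by
  obtain ⟨g₁, u1, a1, b1⟩ := exists_split hT ι F h g hg hx hy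
  obtain ⟨g₂, u2, a2, b2⟩ := exists_split hT ι F h.symm g hg hy hx
  have hxx : x ∈ EdgeSide T x y := by
    simp [EdgeSide, SimpleGraph.dist_eq_one_iff_adj, h.symm]
  have hyy : y ∈ EdgeSide T y x := by
    simp [EdgeSide, SimpleGraph.dist_eq_one_iff_adj, h]
  refine ⟨g₁, g₂, u1, u2, ?_, a1, a2, a1 x hxx, by rw [b1 y hyy, hy], by rw [b2 x hxx, hx],
    a2 y hyy⟩
  ext z
  show g z = g₁ (g₂ z)
  rcases side_cases hT h z with hz | hz
  · rw [b2 z hz, a1]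
    simp only [EdgeSide, Set.mem_ofPred_eq] at *
    have e1 := iso_dist_eq T g x z
    have e2 := iso_dist_eq T g y z
    rw [hx] at e1
    rw [hy] at e2
    omega
  · rw [a2 z hz, b1 z hz]

/-! ### Permutation groups -/

theorem orbit_block {d : ℕ} {F : Subgroup (Equiv.Perm (Fin d))} (hprim : PermPrimitive F)
    (i : Fin d) (L : Subgroup (Equiv.Perm (Fin d))) (hL : L ≤ F)
    (hs : ∀ τ ∈ F, τ i = i → τ ∈ L) :
    (∀ l ∈ L, l i = i) ∨ (∀ k, ∃ l ∈ L, l i = k) := by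
  let O : Set (Fin d) := {k | ∃ l ∈ L, l i = k}
  have hiO : i ∈ O := ⟨1, L.one_mem, rfl⟩
  have hO := hprim.2 O (by
    intro σ hσ
    by_cases hσL : σ ∈ L
    · left
      ext k
      constructor
      · rintro ⟨_, ⟨l, hl, rfl⟩, rfl⟩
        exact ⟨σ * l, L.mul_mem hσL hl, rfl⟩
      · rintro ⟨l, hl, rfl⟩
        exact ⟨σ⁻¹ (l i), ⟨σ⁻¹ * l, L.mul_mem (L.inv_mem hσL) hl, rfl⟩, by simp⟩
    · right
      rw [Set.disjoint_left]
      rintro _ ⟨_, ⟨l, hl, rfl⟩, rfl⟩ ⟨l', hl', h⟩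
      apply hσL
      have h1 : l'⁻¹ * σ * l ∈ L := by
        apply hs
        · exact F.mul_mem (F.mul_mem (F.inv_mem (hL hl')) hσ) (hL hl)
        · simp only [Equiv.Perm.mul_apply]
          rw [← h]
          simp
      have h2 := L.mul_mem (L.mul_mem hl' h1) (L.inv_mem hl)
      simpa [mul_assoc] using h2)
  rcases hO with h | h
  · left
    intro l hl
    exact h ⟨l, hl, rfl⟩ hiO
  · right
    intro k
    have : k ∈ O := by rw [h]; trivial
    exact this

theorem perm_gen {d : ℕ} {F : Subgroup (Equiv.Perm (Fin d))} (hprim : PermPrimitive F)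
    (hncyc : ¬ CyclicOfPrimeOrder F) {i j : Fin d} (hij : i ≠ j) (B : Set (Fin d)) (hi : i ∈ B)
    (hB : ∀ τ ∈ F, (τ i = i ∨ τ j = j) → ∀ k ∈ B, τ k ∈ B) (k : Fin d) : k ∈ B := by
  let L : Subgroup (Equiv.Perm (Fin d)) :=
    Subgroup.closure {τ | τ ∈ F ∧ (τ i = i ∨ τ j = j)}
  have hLF : L ≤ F := (Subgroup.closure_le _).mpr (fun τ h => h.1)
  have hLB : ∀ l ∈ L, ∀ k ∈ B, l k ∈ B := by
    intro l hl
    refine Subgroup.closure_induction'' (p := fun l _ => ∀ k ∈ B, l k ∈ B) ?_ ?_ ?_ ?_ hl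
    · intro τ h
      exact hB τ h.1 h.2
    · intro τ h
      refine hB _ (F.inv_mem h.1) ?_
      rcases h.2 with h | h
      · left
        rw [Equiv.Perm.inv_eq_iff_eq, h]
      · right
        rw [Equiv.Perm.inv_eq_iff_eq, h]
    · intro k hk
      exact hk
    · intro x y _ _ hx hy k hk
      exact hx _ (hy _ hk)
  rcases orbit_block hprim i L hLF (fun τ h1 h2 => Subgroup.subset_closure ⟨h1, Or.inl h2⟩) with h | h
  swap
  · obtain ⟨l, hl, rfl⟩ := h k
    exact hLB l hl i hi
  exfalso
  let R : Fin d → Fin d → Prop := fun k m => ∀ τ ∈ F, τ k = k → τ m = m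
  have hRt : ∀ k m n, R k m → R m n → R k n := fun k m n h1 h2 τ hτ h3 => h2 τ hτ (h1 τ hτ h3)
  have hRi : ∀ σ ∈ F, ∀ k m, R k m → R (σ k) (σ m) := by
    intro σ hσ k m hR τ hτ h3
    have := hR (σ⁻¹ * τ * σ) (F.mul_mem (F.mul_mem (F.inv_mem hσ) hτ) hσ) (by
      simp only [Equiv.Perm.mul_apply]
      rw [h3]; simp)
    simp only [Equiv.Perm.mul_apply] at this
    rw [Equiv.Perm.inv_eq_iff_eq] at this
    exact this
  have hRs : ∀ k m, R k m → R m k := by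
    intro k m hR
    obtain ⟨σ, hσ, rfl⟩ := hprim.1 k m
    have : ∀ n : ℕ, R (σ k) ((σ ^ (n + 1)) k) := by
      intro n
      induction n with
      | zero => simpa using fun τ hτ h => h
      | succ n ih =>
        refine hRt _ _ _ ih ?_
        have := hRi (σ ^ (n + 1)) (F.pow_mem hσ _) _ _ hR
        rwa [← Equiv.Perm.mul_apply, ← pow_succ] at this
    have h1 := this (orderOf σ - 1)
    have h2 : 0 < orderOf σ := orderOf_pos σ
    rw [Nat.sub_add_cancel h2, pow_orderOf_eq_one] at h1
    exact h1
  have hC := hprim.2 {k | R k i} (by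
    intro σ hσ
    by_cases hS : R (σ i) i
    · left
      have hS' := hRs _ _ hS
      ext m
      constructor
      · rintro ⟨k, hk, rfl⟩
        exact hRt _ _ _ (hRi σ hσ _ _ hk) hS
      · intro hm
        refine ⟨σ⁻¹ m, ?_, by simp⟩
        have := hRi σ⁻¹ (F.inv_mem hσ) _ _ (hRt _ _ _ hm hS')
        simpa using this
    · right
      rw [Set.disjoint_left]
      rintro _ ⟨k, hk, rfl⟩ h2
      exact hS (hRt _ _ _ (hRs _ _ (hRi σ hσ _ _ hk)) h2))
  have hiC : i ∈ {k | R k i} := fun τ _ h => h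
  have hjC : j ∈ {k | R k i} := fun τ hτ h' => h τ (Subgroup.subset_closure ⟨hτ, Or.inr h'⟩)
  rcases hC with hC | hC
  · exact hij (hC hiC hjC)
  have hfree : ∀ τ ∈ F, τ i = i → τ = 1 := by
    intro τ hτ hh
    ext m
    have hm : m ∈ {k | R k i} := by rw [hC]; trivial
    have := hRs _ _ hm τ hτ hh
    rw [this]; rfl
  apply hncyc
  have hcard : Nat.card F ≠ 1 := by
    intro hc
    obtain ⟨σ, hσ, hσi⟩ := hprim.1 i j
    have := (Subgroup.card_eq_one.mp hc)
    rw [this, Subgroup.mem_bot] at hσ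
    rw [hσ] at hσi
    exact hij hσi
  obtain ⟨p, hp, hpd⟩ := Nat.exists_prime_and_dvd hcard
  have : Fact p.Prime := ⟨hp⟩
  obtain ⟨x, hx⟩ := exists_prime_orderOf_dvd_card' p hpd
  have hxF : Subgroup.zpowers (x : Equiv.Perm (Fin d)) ≤ F := by
    rw [Subgroup.zpowers_le]; exact x.2
  have hcF : Nat.card F = p := by
    rcases orbit_block hprim i (Subgroup.zpowers (x : Equiv.Perm (Fin d))) hxF
      (fun τ hτ hh => by rw [hfree τ hτ hh]; exact Subgroup.one_mem _) with h | h
    · have h1 := hfree x x.2 (h _ (Subgroup.mem_zpowers _))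
      have h2 : x = 1 := Subtype.ext h1
      rw [h2, orderOf_one] at hx
      exact absurd hx.symm hp.one_lt.ne'
    · have : F = Subgroup.zpowers (x : Equiv.Perm (Fin d)) := by
        refine le_antisymm ?_ hxF
        intro σ hσ
        obtain ⟨l, hl, hli⟩ := h (σ i)
        have := hfree (l⁻¹ * σ) (F.mul_mem (F.inv_mem (hxF hl)) hσ) (by
          simp only [Equiv.Perm.mul_apply]
          rw [← hli]; simp)
        rw [inv_mul_eq_one] at this
        rwa [← this]
      have h1 := Nat.card_zpowers (x : Equiv.Perm (Fin d))
      rw [← this, Subgroup.orderOf_coe, hx] at h1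
      exact h1
  exact ⟨isCyclic_of_prime_card hcF, hcF ▸ hp⟩

/-! ### Universal groups -/

theorem inUF_mul {T : SimpleGraph V} {d : ℕ} {ι : LegalColoring T d}
    {F : Subgroup (Equiv.Perm (Fin d))} {g h : T ≃g T} (hg : InUF T F ι g) (hh : InUF T F ι h) :
    InUF T F ι (g * h) := by
  intro x
  obtain ⟨σ, hσ, h1⟩ := hh x
  obtain ⟨τ, hτ, h2⟩ := hg (h x)
  refine ⟨τ * σ, F.mul_mem hτ hσ, fun y hy => ?_⟩
  show τ (σ _) = ι.color (g (h x)) (g (h y))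
  rw [h1 y hy, h2 _ (h.map_adj_iff.mpr hy)]

theorem inUF_one {T : SimpleGraph V} {d : ℕ} {ι : LegalColoring T d}
    {F : Subgroup (Equiv.Perm (Fin d))} : InUF T F ι 1 :=
  fun _ => ⟨1, F.one_mem, fun _ _ => rfl⟩

theorem inUF_inv {T : SimpleGraph V} {d : ℕ} {ι : LegalColoring T d}
    {F : Subgroup (Equiv.Perm (Fin d))} {g : T ≃g T} (hg : InUF T F ι g) :
    InUF T F ι g⁻¹ := by
  intro x
  obtain ⟨σ, hσ, h1⟩ := hg (g⁻¹ x)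
  refine ⟨σ⁻¹, F.inv_mem hσ, fun y hy => ?_⟩
  have := h1 (g⁻¹ y) ((g⁻¹).map_adj_iff.mpr hy)
  rw [Equiv.Perm.inv_eq_iff_eq, this]
  simp

theorem inUF_of_mem {T : SimpleGraph V} {d : ℕ} {ι : LegalColoring T d}
    {F : Subgroup (Equiv.Perm (Fin d))} {g : T ≃g T} (hg : g ∈ UFplus T F ι) : InUF T F ι g := by
  refine Subgroup.closure_induction (p := fun g _ => InUF T F ι g) (fun g h => h.1) inUF_one
    (fun _ _ _ _ => inUF_mul) (fun _ _ => inUF_inv) hg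

/-- All elements of `U(F)` fixing the edge `(x, y)` lie in `M`. -/
def GoodEdge {T : SimpleGraph V} {d : ℕ} (ι : LegalColoring T d)
    (F : Subgroup (Equiv.Perm (Fin d))) (M : Subgroup (T ≃g T)) (x y : V) : Prop :=
  ∀ g : T ≃g T, InUF T F ι g → g x = x → g y = y → g ∈ M

theorem GoodEdge.conj {T : SimpleGraph V} {d : ℕ} {ι : LegalColoring T d}
    {F : Subgroup (Equiv.Perm (Fin d))} {M : Subgroup (T ≃g T)} (hM : ∀ m ∈ M, InUF T F ι m)
    {x y : V} (h : GoodEdge ι F M x y) {m : T ≃g T} (hm : m ∈ M) :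
    GoodEdge ι F M (m x) (m y) := by
  intro g hg hx hy
  have h1 : m⁻¹ * g * m ∈ M := by
    refine h _ (inUF_mul (inUF_mul (inUF_inv (hM m hm)) hg) (hM m hm)) ?_ ?_
    · show m⁻¹ (g (m x)) = x
      rw [hx]; simp
    · show m⁻¹ (g (m y)) = y
      rw [hy]; simp
  have h2 := M.mul_mem (M.mul_mem hm h1) (M.inv_mem hm)
  simpa [mul_assoc] using h2

theorem star_trans {T : SimpleGraph V} (hT : T.IsTree) {d : ℕ} {ι : LegalColoring T d}
    {F : Subgroup (Equiv.Perm (Fin d))} (hprim : PermPrimitive F) (hncyc : ¬ CyclicOfPrimeOrder F)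
    {M : Subgroup (T ≃g T)}
    {x y₁ y₂ : V} (h1 : T.Adj x y₁) (h2 : T.Adj x y₂) (hne : y₁ ≠ y₂)
    (g1 : GoodEdge ι F M x y₁) (g2 : GoodEdge ι F M x y₂) {y : V} (h : T.Adj x y) :
    ∃ m ∈ M, m x = x ∧ m y₁ = y := by
  have hij : ι.color x y₁ ≠ ι.color x y₂ := fun hc => hne (ι.injOn x h1 h2 hc)
  have := perm_gen hprim hncyc hij {k | ∃ m ∈ M, m x = x ∧ ι.color x (m y₁) = k}
    ⟨1, M.one_mem, rfl, rfl⟩ (by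
      rintro τ hτ hfix _ ⟨m, hm, hmx, rfl⟩
      obtain ⟨g, hgx, hg⟩ := exists_rot hT ι τ x
      have hgF : InUF T F ι g := fun z => ⟨τ, hτ, fun w hw => (hg z w hw).symm⟩
      have hfix' : ∀ w, T.Adj x w → τ (ι.color x w) = ι.color x w → g w = w := by
        intro w hw hc
        have hgw : T.Adj x (g w) := by
          have := g.map_adj_iff.mpr hw
          rwa [hgx] at this
        apply ι.injOn x hgw hw
        have := hg x w hw
        rw [hgx, hc] at this
        exact this
      have hgM : g ∈ M := by
        rcases hfix with hf | hf
        · exact g1 g hgF hgx (hfix' _ h1 hf)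
        · exact g2 g hgF hgx (hfix' _ h2 hf)
      refine ⟨g * m, M.mul_mem hgM hm, ?_, ?_⟩
      · show g (m x) = x
        rw [hmx, hgx]
      · show ι.color x (g (m y₁)) = _
        have hadj : T.Adj x (m y₁) := by
          have := m.map_adj_iff.mpr h1
          rwa [hmx] at this
        have := hg x (m y₁) hadj
        rwa [hgx] at this) (ι.color x y)
  obtain ⟨m, hm, hmx, hc⟩ := this
  refine ⟨m, hm, hmx, ?_⟩
  have hadj : T.Adj x (m y₁) := by
    have := m.map_adj_iff.mpr h1
    rwa [hmx] at this
  exact ι.injOn x hadj h hc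

theorem spread {T : SimpleGraph V} (hT : T.IsTree) {d : ℕ} {ι : LegalColoring T d}
    {F : Subgroup (Equiv.Perm (Fin d))} (hprim : PermPrimitive F) (hncyc : ¬ CyclicOfPrimeOrder F)
    {M : Subgroup (T ≃g T)} (hM : ∀ m ∈ M, InUF T F ι m)
    (hnb : ∀ x y : V, ∃ z, T.Adj x z ∧ y ≠ z)
    {x₀ x₁ x₂ x₃ : V} (h01 : T.Adj x₀ x₁) (h12 : T.Adj x₁ x₂) (h23 : T.Adj x₂ x₃)
    (h02 : x₀ ≠ x₂) (h13 : x₁ ≠ x₃) (g01 : GoodEdge ι F M x₀ x₁) (g12 : GoodEdge ι F M x₁ x₂)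
    (g23 : GoodEdge ι F M x₂ x₃) : ∀ x y, T.Adj x y → GoodEdge ι F M x y := by
  have hsymm : ∀ {x y}, GoodEdge ι F M x y → GoodEdge ι F M y x :=
    fun h g hg hx hy => h g hg hy hx
  have star : ∀ {x y₁ y₂ : V}, T.Adj x y₁ → T.Adj x y₂ → y₁ ≠ y₂ → GoodEdge ι F M x y₁ →
      GoodEdge ι F M x y₂ → ∀ y, T.Adj x y → GoodEdge ι F M x y := by
    intro x y₁ y₂ h1 h2 hne g1 g2 y h
    obtain ⟨m, hm, hmx, hmy⟩ := star_trans hT hprim hncyc h1 h2 hne g1 g2 h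
    have := g1.conj hM hm
    rwa [hmx, hmy] at this
  have hP := tree_induct hT (fun x => (∀ y, T.Adj x y → GoodEdge ι F M x y) ∧
    ∃ y, T.Adj x y ∧ ∀ z, T.Adj y z → GoodEdge ι F M y z) x₁ ?_ ?_
  · intro x y h
    exact (hP x).1 y h
  · exact ⟨star h01.symm h12 h02 (hsymm g01) g12, x₂, h12,
      star h12.symm h23 h13 (hsymm g12) g23⟩
  · rintro x w hxw ⟨hx, y, hxy, hy⟩
    obtain ⟨z, hxz, hyz⟩ := hnb x y
    obtain ⟨m, hm, hmx, hmy⟩ :=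
      star_trans hT hprim hncyc hxy hxz hyz (hx y hxy) (hx z hxz) hxw
    have hw : ∀ v, T.Adj w v → GoodEdge ι F M w v := by
      intro v hv
      have h1 : T.Adj y (m⁻¹ v) := by
        have := (m⁻¹).map_adj_iff.mpr hv
        rw [← hmy] at this
        simpa using this
      have := (hy _ h1).conj hM hm
      rw [hmy] at this
      simpa using this
    exact ⟨hw, x, hxw.symm, hx⟩

/-! ### Parity and the axis -/

theorem dist_parity {T : SimpleGraph V} (hT : T.IsTree) (x y z : V) :
    (T.dist x y + T.dist y z + T.dist x z) % 2 = 0 := by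
  refine tree_induct hT (fun z => (T.dist x y + T.dist y z + T.dist x z) % 2 = 0) y ?_ ?_ z
  · show (T.dist x y + T.dist y y + T.dist x y) % 2 = 0
    rw [SimpleGraph.dist_self]
    omega
  · intro u v h hu
    have h1 := hT.dist_eq_dist_add_one_of_adj x h
    have h2 := hT.dist_eq_dist_add_one_of_adj y h
    show (T.dist x y + T.dist y v + T.dist x v) % 2 = 0
    replace hu : (T.dist x y + T.dist y u + T.dist x u) % 2 = 0 := hu
    omega

theorem even_disp {T : SimpleGraph V} (hT : T.IsTree) {d : ℕ} {ι : LegalColoring T d}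
    {F : Subgroup (Equiv.Perm (Fin d))} {g : T ≃g T} (hg : g ∈ UFplus T F ι) :
    ∀ x, T.dist x (g x) % 2 = 0 := by
  refine Subgroup.closure_induction (p := fun g _ => ∀ x, T.dist x (g x) % 2 = 0) ?_ ?_ ?_ ?_ hg
  · rintro g ⟨-, r, -, -, hr, -⟩ x
    have h1 := dist_parity hT x r (g x)
    have h2 := iso_dist_eq T g r x
    rw [hr, SimpleGraph.dist_comm (u := r) (v := x)] at h2
    omega
  · intro x
    show T.dist x x % 2 = 0
    rw [SimpleGraph.dist_self]
  · intro g h _ _ hg hh x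
    show T.dist x (g (h x)) % 2 = 0
    have h1 := dist_parity hT x (h x) (g (h x))
    have := hg (h x)
    have := hh x
    omega
  · intro g _ hg x
    have h1 := hg (g⁻¹ x)
    rw [SimpleGraph.dist_comm] at h1
    simpa using h1

theorem exists_axis {T : SimpleGraph V} (hT : T.IsTree) (a : T ≃g T) (ha : IsHyperbolic T a)
    (heven : ∀ x, T.dist x (a x) % 2 = 0) :
    ∃ (c : ℤ → V) (ℓ : ℕ), 0 < ℓ ∧ (∀ i, T.Adj (c i) (c (i + 1))) ∧ (∀ i, c i ≠ c (i + 2)) ∧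
      ∀ i, a (c i) = c (i + ℓ) := by
  have hne := hT.connected.nonempty
  obtain ⟨x, hx⟩ : transLen T a ∈ Set.range fun x : V => T.dist x (a x) :=
    Nat.sInf_mem (Set.range_nonempty _)
  have hmin : ∀ y, transLen T a ≤ T.dist y (a y) := fun y => Nat.sInf_le ⟨y, rfl⟩
  have hpos : 0 < transLen T a := ha
  generalize transLen T a = ℓ at hx hmin hpos
  replace hx : T.dist x (a x) = ℓ := hx
  obtain ⟨p, hp⟩ := (hT.connected x (a x)).exists_walk_length_eq_dist
  have hpath := SimpleGraph.Walk.isPath_of_length_eq_dist p hp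
  rw [hx] at hp
  have hP0 : p.getVert 0 = x := p.getVert_zero
  have hPl : p.getVert ℓ = a x := by rw [← hp]; exact p.getVert_length
  have hPadj : ∀ r, r < ℓ → T.Adj (p.getVert r) (p.getVert (r + 1)) :=
    fun r hr => p.adj_getVert_succ (by omega)
  have hPinj : ∀ r s, r ≤ ℓ → s ≤ ℓ → p.getVert r = p.getVert s → r = s := by
    intro r s hr hs h
    exact hpath.getVert_injOn (by simp; omega) (by simp; omega) h
  generalize p.getVert = P at hP0 hPl hPadj hPinj
  have hPd : ∀ r k, r + k ≤ ℓ → T.dist (P r) (P (r + k)) ≤ k := by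
    intro r k
    induction k with
    | zero => intro _; simp
    | succ k ih =>
      intro h
      have h1 := ih (by omega)
      have h2 := hPadj (r + k) (by omega)
      have h3 := hT.connected.dist_triangle (u := P r) (v := P (r + k)) (w := P (r + k + 1))
      rw [SimpleGraph.dist_eq_one_iff_adj.mpr h2] at h3
      rw [← add_assoc]
      omega
  have hl2 : 2 ≤ ℓ := by
    have := heven x
    omega
  let c : ℤ → V := fun i => (a ^ (i / (ℓ : ℤ))) (P (i % (ℓ : ℤ)).toNat)
  have hc' : ∀ (q : ℤ) (r : ℕ), r < ℓ → c (q * ℓ + r) = (a ^ q) (P r) := by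
    intro q r hr
    have h1 : (q * (ℓ : ℤ) + r) / (ℓ : ℤ) = q := by
      rw [add_comm, Int.add_mul_ediv_right _ _ (by omega), Int.ediv_eq_zero_of_lt (by omega) (by omega)]
      simp
    have h2 : (q * (ℓ : ℤ) + r) % (ℓ : ℤ) = r := by
      rw [add_comm, Int.add_mul_emod_self_right, Int.emod_eq_of_lt (by omega) (by omega)]
    show (a ^ ((q * (ℓ : ℤ) + r) / (ℓ : ℤ))) (P ((q * (ℓ : ℤ) + r) % (ℓ : ℤ)).toNat) = _
    rw [h1, h2]
    simp
  have hc : ∀ (q : ℤ) (r : ℕ), r ≤ ℓ → c (q * ℓ + r) = (a ^ q) (P r) := by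
    intro q r hr
    rcases hr.lt_or_eq with h | rfl
    · exact hc' q r h
    · have := hc' (q + 1) 0 (by omega)
      rw [hP0, zpow_add_one] at this
      rw [hPl]
      rw [show q * (r : ℤ) + r = (q + 1) * r + ((0 : ℕ) : ℤ) by push_cast; ring]
      exact this
  have hrep : ∀ i : ℤ, ∃ (q : ℤ) (r : ℕ), r < ℓ ∧ i = q * ℓ + r := by
    intro i
    refine ⟨i / ℓ, (i % ℓ).toNat, ?_, ?_⟩
    · have := Int.emod_lt_of_pos i (b := (ℓ : ℤ)) (by omega)
      omega
    · have h1 := Int.emod_nonneg i (b := (ℓ : ℤ)) (by omega)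
      rw [Int.toNat_of_nonneg h1, mul_comm]
      exact (Int.mul_ediv_add_emod i ℓ).symm
  refine ⟨c, ℓ, hpos, ?_, ?_, ?_⟩
  · intro i
    obtain ⟨q, r, hr, rfl⟩ := hrep i
    have h2 := hc q (r + 1) (by omega)
    push_cast at h2
    rw [← add_assoc] at h2
    rw [hc q r hr.le, h2]
    exact (a ^ q).map_adj_iff.mpr (hPadj r hr)
  · intro i
    obtain ⟨q, r, hr, rfl⟩ := hrep i
    by_cases hr2 : r + 2 ≤ ℓ
    · have h2 := hc q (r + 2) (by omega)
      push_cast at h2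
      rw [← add_assoc] at h2
      rw [hc q r hr.le, h2]
      intro h
      have := hPinj _ _ hr.le hr2 ((a ^ q).injective h)
      omega
    · have h2 := hc (q + 1) 1 (by omega)
      have h3 : (q + 1) * (ℓ : ℤ) + ((1 : ℕ) : ℤ) = q * ℓ + r + 2 := by
        have : (ℓ : ℤ) = r + 1 := by omega
        rw [this]; push_cast; ring
      rw [h3, zpow_add_one] at h2
      rw [hc q r hr.le, h2]
      intro h
      have h4 : P r = a (P 1) := (a ^ q).injective h
      have h5 := hPd 1 (r - 1) (by omega)
      rw [show 1 + (r - 1) = r by omega, h4] at h5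
      have := hmin (P 1)
      omega
  · intro i
    obtain ⟨q, r, hr, rfl⟩ := hrep i
    have h2 := hc (q + 1) r hr.le
    rw [add_comm q 1, zpow_one_add] at h2
    rw [hc q r hr.le, show q * (ℓ : ℤ) + r + ℓ = (1 + q) * ℓ + r by ring, h2]
    rfl

theorem eventually_incr {T : SimpleGraph V} (hT : T.IsTree) (c : ℤ → V)
    (hadj : ∀ i, T.Adj (c i) (c (i + 1))) (hne : ∀ i, c i ≠ c (i + 2)) (z : V) :
    ∃ N, ∀ i, N ≤ i → T.dist z (c (i + 1)) = T.dist z (c i) + 1 := by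
  have hex : ∃ N, T.dist z (c (N + 1)) = T.dist z (c N) + 1 := by
    by_contra hcon
    push Not at hcon
    have hdec : ∀ n : ℕ, T.dist z (c n) + n = T.dist z (c 0) := by
      intro n
      induction n with
      | zero => simp
      | succ n ih =>
        have h1 := hT.dist_eq_dist_add_one_of_adj z (hadj n)
        have h2 := hcon n
        push_cast
        omega
    have := hdec (T.dist z (c 0) + 1)
    omega
  obtain ⟨N, hN⟩ := hex
  refine ⟨N, fun i hi => ?_⟩
  induction i, hi using Int.leInduction with
  | base => exact hN
  | succ i hi ih =>
    rcases hT.dist_eq_dist_add_one_of_adj z (hadj (i + 1)) with h | h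
    · exfalso
      apply hne i
      have := parent_unique hT z (hadj i).symm (hadj (i + 1)) ih.symm h.symm
      rw [this, add_assoc]
      rfl
    · exact h

theorem eventually_side {T : SimpleGraph V} (hT : T.IsTree) (a : T ≃g T) (c : ℤ → V) (ℓ : ℕ)
    (hl : 0 < ℓ) (hadj : ∀ i, T.Adj (c i) (c (i + 1))) (hne : ∀ i, c i ≠ c (i + 2))
    (hac : ∀ i, a (c i) = c (i + ℓ)) (i : ℤ) (z : V) :
    (∀ᶠ n : ℕ in atTop, (a ^ n) z ∈ EdgeSide T (c (i + 1)) (c i)) ∧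
    (∀ᶠ n : ℕ in atTop, (a ^ n)⁻¹ z ∈ EdgeSide T (c i) (c (i + 1))) := by
  have hpow : ∀ (n : ℕ) (j : ℤ), (a ^ n) (c j) = c (j + n * ℓ) := by
    intro n
    induction n with
    | zero => intro j; simp
    | succ n ih =>
      intro j
      rw [pow_succ]
      show (a ^ n) (a (c j)) = _
      rw [hac, ih]
      congr 1
      push_cast
      ring
  constructor
  · obtain ⟨N, hN⟩ := eventually_incr hT (fun i => c (-i)) (fun i => by
      have := (hadj (-(i + 1))).symm
      rwa [show -(i + 1) + 1 = -i by ring] at this) (fun i => by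
      have := (hne (-(i + 2))).symm
      rwa [show -(i + 2) + 2 = -i by ring] at this) z
    filter_upwards [eventually_ge_atTop (N + i + 1).toNat] with n hn
    have h1 : N ≤ n * ℓ - i - 1 := by nlinarith [Int.self_le_toNat (N + i + 1)]
    have h2 := hN _ h1
    have e1 : c i = (a ^ n) (c (-(n * ℓ - i - 1 + 1))) := by
      rw [hpow]; congr 1; ring
    have e2 : c (i + 1) = (a ^ n) (c (-(n * ℓ - i - 1))) := by
      rw [hpow]; congr 1; ring
    show T.dist (c i) _ = T.dist (c (i + 1)) _ + 1
    rw [e1, e2, iso_dist_eq, iso_dist_eq, SimpleGraph.dist_comm, h2, SimpleGraph.dist_comm]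
  · obtain ⟨N, hN⟩ := eventually_incr hT c hadj hne z
    filter_upwards [eventually_ge_atTop (N - i).toNat] with n hn
    have h1 : N ≤ i + n * ℓ := by nlinarith [Int.self_le_toNat (N - i)]
    have h2 := hN _ h1
    show T.dist (c (i + 1)) _ = T.dist (c i) _ + 1
    rw [← iso_dist_eq T (a ^ n), ← iso_dist_eq T (a ^ n) (c i), hpow, hpow]
    rw [show i + 1 + n * ℓ = i + n * ℓ + 1 by ring]
    simp only [RelIso.apply_inv_self]
    rw [SimpleGraph.dist_comm, h2, SimpleGraph.dist_comm]

/-! ### The Mautner-type argument -/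

section Mautner

variable {G : Type} [Group G] [TopologicalSpace G] {H : Type} [NormedAddCommGroup H]
  [InnerProductSpace ℂ H]

/-- Vectors against which all orbits `π(bⁿ)v` tend weakly to zero. -/
def WeakNull (π : UnitaryRep G H) (b : G) : Submodule ℂ H where
  carrier := {w | ∀ v : H, Tendsto (fun n : ℕ => ⟪π.ρ (b ^ n) v, w⟫_ℂ) atTop (𝓝 0)}
  add_mem' := by
    intro x y hx hy v
    have := (hx v).add (hy v)
    simpa [inner_add_right] using this
  zero_mem' := by
    intro v
    simp
  smul_mem' := by
    intro k x hx v
    have := (hx v).const_mul k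
    simpa [inner_smul_right] using this

theorem weakNull_closed (π : UnitaryRep G H) (b : G) :
    IsClosed (WeakNull π b : Set H) := by
  rw [← closure_subset_iff_isClosed]
  intro w hw v
  rw [Metric.tendsto_atTop]
  intro ε hε
  obtain ⟨w', hw', hd⟩ := Metric.mem_closure_iff.mp hw (ε / (2 * (‖v‖ + 1))) (by positivity)
  obtain ⟨N, hN⟩ := Metric.tendsto_atTop.mp (hw' v) (ε / 2) (by positivity)
  refine ⟨N, fun n hn => ?_⟩
  have h1 := hN n hn
  rw [dist_zero_right] at h1 ⊢
  have h2 : ⟪π.ρ (b ^ n) v, w⟫_ℂ = ⟪π.ρ (b ^ n) v, w - w'⟫_ℂ + ⟪π.ρ (b ^ n) v, w'⟫_ℂ := by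
    rw [← inner_add_right, sub_add_cancel]
  have h3 : ‖⟪π.ρ (b ^ n) v, w - w'⟫_ℂ‖ ≤ ‖v‖ * ‖w - w'‖ := by
    have := norm_inner_le_norm (𝕜 := ℂ) (π.ρ (b ^ n) v) (w - w')
    rwa [LinearIsometryEquiv.norm_map] at this
  rw [dist_eq_norm] at hd
  have h4 : ‖v‖ * ‖w - w'‖ ≤ ε / 2 := by
    have : (‖v‖ + 1) * ‖w - w'‖ ≤ (‖v‖ + 1) * (ε / (2 * (‖v‖ + 1))) := by gcongr
    have h5 : (‖v‖ + 1) * (ε / (2 * (‖v‖ + 1))) = ε / 2 := by field_simp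
    nlinarith [norm_nonneg (w - w')]
  rw [h2]
  have := norm_add_le ⟪π.ρ (b ^ n) v, w - w'⟫_ℂ ⟪π.ρ (b ^ n) v, w'⟫_ℂ
  linarith

theorem rep_mul (π : UnitaryRep G H) (g h : G) (v : H) :
    π.ρ (g * h) v = π.ρ g (π.ρ h v) := by
  rw [map_mul]; rfl

theorem rep_inner_inv (π : UnitaryRep G H) (g : G) (v w : H) :
    ⟪v, π.ρ g⁻¹ w⟫_ℂ = ⟪π.ρ g v, w⟫_ℂ := by
  rw [← LinearIsometryEquiv.inner_map_map (π.ρ g) v, ← rep_mul]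
  simp

theorem weakNull_sub (π : UnitaryRep G H) (b g : G)
    (hg : Tendsto (fun n : ℕ => (b ^ n)⁻¹ * g * b ^ n) atTop (𝓝 1)) (w : H) :
    π.ρ g⁻¹ w - w ∈ WeakNull π b := by
  intro v
  have h1 : Tendsto (fun n : ℕ => ‖π.ρ ((b ^ n)⁻¹ * g * b ^ n) v - v‖ * ‖w‖) atTop (𝓝 0) := by
    have h2 := ((π.strong_continuity v).tendsto 1).comp hg
    have h3 := ((h2.sub_const v).norm).mul_const ‖w‖
    simpa using h3
  refine squeeze_zero_norm (fun n => ?_) h1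
  have h4 : ⟪π.ρ (b ^ n) v, π.ρ g⁻¹ w - w⟫_ℂ =
      ⟪π.ρ (b ^ n) (π.ρ ((b ^ n)⁻¹ * g * b ^ n) v - v), w⟫_ℂ := by
    rw [inner_sub_right, rep_inner_inv, map_sub, inner_sub_left, ← rep_mul, ← rep_mul]
    simp [mul_assoc]
  rw [h4]
  have := norm_inner_le_norm (𝕜 := ℂ) (π.ρ (b ^ n) (π.ρ ((b ^ n)⁻¹ * g * b ^ n) v - v)) w
  rwa [LinearIsometryEquiv.norm_map] at this

theorem fixed_of_orthogonal (π : UnitaryRep G H) (b g : G)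
    (hg : Tendsto (fun n : ℕ => (b ^ n)⁻¹ * g * b ^ n) atTop (𝓝 1)) (u : H)
    (hu : u ∈ (WeakNull π b)ᗮ) : π.ρ g u = u := by
  rw [← sub_eq_zero, ← inner_self_eq_zero (𝕜 := ℂ)]
  generalize hw : π.ρ g u - u = w
  have h1 : ⟪π.ρ g u - u, w⟫_ℂ = 0 := by
    rw [inner_sub_left, ← rep_inner_inv, ← inner_sub_right]
    have := (Submodule.mem_orthogonal _ _).mp hu _ (weakNull_sub π b g hg w)
    exact inner_eq_zero_symm.mp this
  rwa [hw] at h1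

theorem weakNull_invariant (π : UnitaryRep G H) (b : G) (w : H) (hw : w ∈ WeakNull π b) (n : ℕ) :
    π.ρ (b ^ n) w ∈ WeakNull π b := by
  intro v
  have := hw (π.ρ (b ^ n)⁻¹ v)
  refine this.congr (fun m => ?_)
  rw [← LinearIsometryEquiv.inner_map_map (π.ρ (b ^ n)), ← rep_mul, ← rep_mul]
  congr 4
  rw [← pow_add, add_comm, pow_add, mul_inv_cancel_right]

theorem inner_pow_inv (π : UnitaryRep G H) (a : G) (v w : H) (n : ℕ) :
    ⟪π.ρ (a⁻¹ ^ n) w, v⟫_ℂ = (starRingEnd ℂ) ⟪π.ρ (a ^ n) v, w⟫_ℂ := by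
  rw [inner_conj_symm, inv_pow, ← rep_inner_inv, inv_inv]

theorem weakNull_le [CompleteSpace H] (π : UnitaryRep G H) (a : G) :
    WeakNull π a ≤ WeakNull π a⁻¹ := by
  intro v hv w
  have hcl : CompleteSpace (WeakNull π a) := (weakNull_closed π a).completeSpace_coe
  obtain ⟨w₁, h₁, w₂, h₂, rfl⟩ := Submodule.exists_add_mem_mem_orthogonal (K := WeakNull π a) w
  have h3 : Tendsto (fun n : ℕ => ⟪π.ρ (a ^ n) v, w₁ + w₂⟫_ℂ) atTop (𝓝 0) := by
    refine (h₁ v).congr (fun n => ?_)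
    rw [inner_add_right,
      (Submodule.mem_orthogonal _ _).mp h₂ _ (weakNull_invariant π a v hv n), add_zero]
  have h4 := (Complex.continuous_conj.tendsto _).comp h3
  rw [map_zero] at h4
  exact h4.congr (fun n => (inner_pow_inv π a v _ n).symm)

theorem mautner [CompleteSpace H] (π : UnitaryRep G H) (a : G)
    (hfix : ∀ u : H, (∀ g, Tendsto (fun n : ℕ => (a ^ n)⁻¹ * g * a ^ n) atTop (𝓝 1) →
        π.ρ g u = u) →
      (∀ g, Tendsto (fun n : ℕ => a ^ n * g * (a ^ n)⁻¹) atTop (𝓝 1) → π.ρ g u = u) → u = 0)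
    (v w : H) : Tendsto (fun n : ℕ => ⟪π.ρ (a ^ n) v, w⟫_ℂ) atTop (𝓝 0) := by
  have hcl : CompleteSpace (WeakNull π a⁻¹) := (weakNull_closed π a⁻¹).completeSpace_coe
  have hbot : (WeakNull π a⁻¹)ᗮ = ⊥ := by
    rw [eq_bot_iff]
    intro u hu
    rw [Submodule.mem_bot]
    apply hfix
    · intro g hg
      exact fixed_of_orthogonal π a g hg u (Submodule.orthogonal_le (weakNull_le π a) hu)
    · intro g hg
      refine fixed_of_orthogonal π a⁻¹ g ?_ u hu
      simpa using hg
  rw [Submodule.orthogonal_eq_bot_iff] at hbot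
  have hv : v ∈ WeakNull π a⁻¹ := by rw [hbot]; trivial
  have h4 := (Complex.continuous_conj.tendsto _).comp (hv w)
  rw [map_zero] at h4
  refine h4.congr (fun n => ?_)
  show (starRingEnd ℂ) ⟪π.ρ (a⁻¹ ^ n) w, v⟫_ℂ = _
  rw [inner_pow_inv, Complex.conj_conj]

end Mautner

theorem tendsto_one_of_eventually {T : SimpleGraph V} (G : Subgroup (T ≃g T)) (f : ℕ → G)
    (hf : ∀ z : V, ∀ᶠ n in atTop, (f n : T ≃g T) z = z) : Tendsto f atTop (𝓝 1) := by
  rw [tendsto_subtype_rng]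
  letI : TopologicalSpace V := ⊥
  haveI : DiscreteTopology V := ⟨rfl⟩
  have hind : Topology.IsInducing (fun (g : T ≃g T) (x : V) => g x) := ⟨rfl⟩
  rw [hind.tendsto_nhds_iff, tendsto_pi_nhds]
  intro z
  refine tendsto_nhds_of_eventually_eq ?_
  filter_upwards [hf z] with n hn
  exact hn

theorem fixed_zero {T : SimpleGraph V} {d : ℕ} (hd : 3 ≤ d)
    (hT : T.IsTree) (ι : LegalColoring T d) (F : Subgroup (Equiv.Perm (Fin d)))
    (hprim : PermPrimitive F) (hncyc : ¬ CyclicOfPrimeOrder F)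
    (a : UFplus T F ι) (ha : IsHyperbolic T (a : T ≃g T))
    {H : Type} [NormedAddCommGroup H] [InnerProductSpace ℂ H]
    (π : UnitaryRep (UFplus T F ι) H) (hnoinv : NoInvariantVectors π) (u : H)
    (hp : ∀ g, Tendsto (fun n : ℕ => (a ^ n)⁻¹ * g * a ^ n) atTop (𝓝 1) → π.ρ g u = u)
    (hm : ∀ g, Tendsto (fun n : ℕ => a ^ n * g * (a ^ n)⁻¹) atTop (𝓝 1) → π.ρ g u = u) :
    u = 0 := by
  obtain ⟨c, ℓ, hl, hadj, hne, hac⟩ := exists_axis hT (a : T ≃g T) ha (even_disp hT a.2)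
  let S : Subgroup (UFplus T F ι) :=
    { carrier := {g | π.ρ g u = u}
      mul_mem' := by
        intro g h hg hh
        show π.ρ (g * h) u = u
        rw [rep_mul, show π.ρ h u = u from hh, show π.ρ g u = u from hg]
      one_mem' := by
        show π.ρ 1 u = u
        simp
      inv_mem' := by
        intro g hg
        show π.ρ g⁻¹ u = u
        have : π.ρ g⁻¹ (π.ρ g u) = u := by rw [← rep_mul]; simp
        rwa [show π.ρ g u = u from hg] at this }
  let M : Subgroup (T ≃g T) := S.map (UFplus T F ι).subtype
  have hM : ∀ m ∈ M, InUF T F ι m := by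
    rintro _ ⟨g, -, rfl⟩
    exact inUF_of_mem g.2
  have hedge : ∀ i, GoodEdge ι F M (c i) (c (i + 1)) := by
    intro i g hg hx hy
    obtain ⟨g₁, g₂, u1, u2, rfl, s1, s2, x1, y1, x2, y2⟩ :=
      exists_tits hT ι F (hadj i) g hg hx hy
    have m1 : g₁ ∈ UFplus T F ι := Subgroup.subset_closure ⟨u1, _, _, hadj i, x1, y1⟩
    have m2 : g₂ ∈ UFplus T F ι := Subgroup.subset_closure ⟨u2, _, _, hadj i, x2, y2⟩
    have f1 : π.ρ ⟨g₁, m1⟩ u = u := by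
      apply hm
      apply tendsto_one_of_eventually
      intro z
      filter_upwards [(eventually_side hT (a : T ≃g T) c ℓ hl hadj hne hac i z).2] with n hn
      show ((a : T ≃g T) ^ n) (g₁ (((a : T ≃g T) ^ n)⁻¹ z)) = z
      rw [s1 _ hn]
      simp
    have f2 : π.ρ ⟨g₂, m2⟩ u = u := by
      apply hp
      apply tendsto_one_of_eventually
      intro z
      filter_upwards [(eventually_side hT (a : T ≃g T) c ℓ hl hadj hne hac i z).1] with n hn
      show ((a : T ≃g T) ^ n)⁻¹ (g₂ (((a : T ≃g T) ^ n) z)) = z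
      rw [s2 _ hn]
      simp
    exact M.mul_mem ⟨⟨g₁, m1⟩, f1, rfl⟩ ⟨⟨g₂, m2⟩, f2, rfl⟩
  have hnb : ∀ x y : V, ∃ z, T.Adj x z ∧ y ≠ z := by
    intro x y
    have : Nontrivial (Fin d) := Fin.nontrivial_iff_two_le.mpr (by omega)
    obtain ⟨k, hk⟩ := exists_ne (ι.color x y)
    obtain ⟨z, hz, hc⟩ := ι.surjOn x (Set.mem_univ k)
    refine ⟨z, hz, ?_⟩
    rintro rfl
    exact hk hc.symm
  have hall := spread hT hprim hncyc hM hnb (hadj 0) (hadj (0 + 1)) (hadj (0 + 1 + 1))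
    (hne 0) (hne (0 + 1)) (hedge 0) (hedge _) (hedge _)
  have hle : UFplus T F ι ≤ M := by
    refine (Subgroup.closure_le _).mpr ?_
    rintro g ⟨hg, x, y, hxy, hx, hy⟩
    exact hall x y hxy g hg hx hy
  apply hnoinv
  intro g
  obtain ⟨g', hg', he⟩ := hle g.2
  have : g' = g := Subtype.ext he
  rw [← this]
  exact hg'

/-- Let `F` be primitive but not cyclic of prime order, `𝔾 = U(F)⁺`,
`a ∈ 𝔾` hyperbolic and `(π, ℋ)` a unitary representation of `𝔾` on a separable Hilbert
space without nonzero invariant vectors.  Then all matrix coefficients along `(aⁿ)` tend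
to zero. -/
theorem matrix_coefficients_along_hyperbolic_tend_to_zero
    {V : Type} (T : SimpleGraph V) (d : ℕ) (hd : 3 ≤ d)
    (hT : T.IsTree) (hreg : Regular T d) (ι : LegalColoring T d)
    (F : Subgroup (Equiv.Perm (Fin d)))
    (hprim : PermPrimitive F) (hncyc : ¬ CyclicOfPrimeOrder F)
    (a : UFplus T F ι) (ha : IsHyperbolic T (a : T ≃g T))
    (H : Type) [NormedAddCommGroup H] [InnerProductSpace ℂ H] [CompleteSpace H]
    [TopologicalSpace.SeparableSpace H]
    (π : UnitaryRep (UFplus T F ι) H) (hnoinv : NoInvariantVectors π) :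
    ∀ v w : H, Tendsto (fun n : ℕ => ⟪π.ρ (a ^ n) v, w⟫_ℂ) atTop (𝓝 0) := by
  intro v w
  exact mautner π a (fun u hp hm =>
    fixed_zero hd hT ι F hprim hncyc a ha π hnoinv u hp hm) v w

end TreeHM
end

section
/- Let T be a locally finite tree and let a ∈ Aut(T) be a hyperbolic element with attracting end ξ₊ ∈ ∂T. Then the contraction group U⁺_a = {g ∈ Aut(T) : a⁻ⁿ g aⁿ → e as n → ∞} is contained in {g ∈ Aut(T) : g(ξ₊) = ξ₊ and g fixes some vertex of T}; similarly U⁻_a = {g ∈ Aut(T) : aⁿ g a⁻ⁿ → e as n → ∞} is contained in {g ∈ Aut(T) : g(ξ₋) = ξ₋ and g fixes some vertex of T}, where ξ₋ is the repelling end of a. -/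
open Filter Topology
open scoped InnerProductSpace

namespace TreeHM

variable {V : Type}

theorem fix_of_mem_path {V : Type} (T : SimpleGraph V) (hT : T.IsTree) (g : T ≃g T)
    {z y u : V} (p : T.Walk z y) (hp : p.IsPath) (hz : g z = z) (hy : g y = y)
    (hu : u ∈ p.support) : g u = u := by
  have h1 : ((p.map g.toHom).copy hz hy).IsPath := by
    rw [SimpleGraph.Walk.isPath_copy]
    exact SimpleGraph.Walk.map_isPath_of_injective g.injective hp
  have h2 : (p.map g.toHom).copy hz hy = p := by
    have := hT.isAcyclic.path_unique ⟨_, h1⟩ ⟨p, hp⟩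
    exact congrArg Subtype.val this
  obtain ⟨i, hi, -⟩ := SimpleGraph.Walk.mem_support_iff_exists_getVert.1 hu
  have h3 : ((p.map g.toHom).copy hz hy).getVert i = p.getVert i := by rw [h2]
  rw [SimpleGraph.Walk.getVert_copy, SimpleGraph.Walk.getVert_map, hi] at h3
  exact h3

theorem mem_support_of_between {V : Type} (T : SimpleGraph V) (hT : T.IsTree)
    {x y u : V} (h : T.dist x y = T.dist x u + T.dist u y) (q : T.Walk x y) :
    u ∈ q.support := by
  classical
  obtain ⟨p1, h1⟩ := (hT.connected.preconnected x u).exists_walk_length_eq_dist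
  obtain ⟨p2, h2⟩ := (hT.connected.preconnected u y).exists_walk_length_eq_dist
  have hp : (p1.append p2).IsPath := by
    apply SimpleGraph.Walk.isPath_of_length_eq_dist
    rw [SimpleGraph.Walk.length_append]; omega
  have h3 := hT.isAcyclic.path_unique ⟨_, hp⟩ q.toPath
  have h4 : p1.append p2 = (q.toPath : T.Walk x y) := congrArg Subtype.val h3
  apply SimpleGraph.Walk.support_toPath_subset q
  rw [← h4, SimpleGraph.Walk.mem_support_append_iff]
  exact Or.inl p1.end_mem_support

theorem eventually_fix {V : Type} (T : SimpleGraph V) (a g : T ≃g T) (hg : g ∈ Upos a) (x : V) :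
    ∀ᶠ n in atTop, g ((a ^ n) x) = (a ^ n) x := by
  letI : TopologicalSpace V := ⊥
  haveI : DiscreteTopology V := ⟨rfl⟩
  have hc : Continuous (fun (h : T ≃g T) (x : V) => h x) := continuous_induced_dom
  have hx : Continuous (fun (h : T ≃g T) => h x) := (continuous_apply x).comp hc
  have h1 : Tendsto (fun n : ℕ => (a ^ n)⁻¹ * g * a ^ n) atTop (𝓝 1) := hg
  have h2 := (hx.tendsto 1).comp h1
  have h3 := h2.eventually (IsOpen.mem_nhds (isOpen_discrete {(1 : T ≃g T) x}) rfl)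
  filter_upwards [h3] with n hn
  have h4 : ((a ^ n)⁻¹ * g * a ^ n) x = x := hn
  have h5 := congrArg (fun v => (a ^ n) v) h4
  have h6 : (a ^ n * ((a ^ n)⁻¹ * g * a ^ n)) x = (a ^ n) x := h5
  rw [show a ^ n * ((a ^ n)⁻¹ * g * a ^ n) = g * a ^ n by group] at h6
  exact h6

theorem upos_aux {V : Type} (T : SimpleGraph V) (hT : T.IsTree) (a : T ≃g T)
    (r : GeodRay T) (hr : IsAttractingEnd T a r) (g : T ≃g T) (hg : g ∈ Upos a) :
    FixesEnd T g r ∧ ∃ x : V, g x = x := by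
  classical
  have hev := eventually_fix T a g hg (r.seq 0)
  obtain ⟨N, hN⟩ := hev.exists
  refine ⟨?_, _, hN⟩
  set z := (a ^ N) (r.seq 0) with hz
  obtain ⟨w, hw⟩ := (hT.connected.preconnected (r.seq 0) z).exists_walk_length_eq_dist
  refine ⟨T.dist (r.seq 0) z + 1, T.dist (r.seq 0) z + 1, fun n => ?_⟩
  change g (r.seq _) = r.seq _
  set m := T.dist (r.seq 0) z + 1 + n with hm
  obtain ⟨k, hk, hkm⟩ := (hev.and (hr m)).exists
  have h0 : T.dist (r.seq 0) (r.seq m) = m := by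
    rw [r.geodesic]; simp [Nat.dist]
  obtain ⟨p, hp⟩ := (hT.connected.preconnected z ((a ^ k) (r.seq 0))).exists_isPath
  have hmem := mem_support_of_between T hT (u := r.seq m) (by rw [h0]; exact hkm) (w.append p)
  rw [SimpleGraph.Walk.mem_support_append_iff] at hmem
  rcases hmem with h | h
  · exfalso
    have h7 := SimpleGraph.dist_le (w.takeUntil _ h)
    have h8 := w.length_takeUntil_le h
    omega
  · exact fix_of_mem_path T hT g p hp hN hk h

/-- Let `T` be a locally finite tree and `a ∈ Aut(T)` hyperbolic with
attracting end `ξ₊` and repelling end `ξ₋`.  Then `U⁺_a` consists of elements fixing `ξ₊`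
and some vertex, and `U⁻_a` consists of elements fixing `ξ₋` and some vertex. -/
theorem contraction_group_subset_end_stabilizer
    {V : Type} (T : SimpleGraph V) (hT : T.IsTree) (hlf : LocFin T)
    (a : T ≃g T) (ha : IsHyperbolic T a)
    (ξp : GeodRay T) (hξp : IsAttractingEnd T a ξp)
    (ξm : GeodRay T) (hξm : IsAttractingEnd T a⁻¹ ξm) :
    (∀ g ∈ Upos a, FixesEnd T g ξp ∧ ∃ x : V, g x = x) ∧
      (∀ g ∈ Uneg a, FixesEnd T g ξm ∧ ∃ x : V, g x = x) := by
  refine ⟨fun g hg => upos_aux T hT a ξp hξp g hg, fun g hg => ?_⟩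
  refine upos_aux T hT a⁻¹ ξm hξm g ?_
  have h : (fun n : ℕ => a⁻¹ ^ n) = fun n : ℕ => (a ^ n)⁻¹ := by
    funext n; exact inv_pow a n
  unfold Upos
  rw [h]
  exact hg

end TreeHM
end

section
/- Let T be a locally finite tree and let G ≤ Aut(T) be a closed subgroup with Tits' independence property. Let a ∈ G be a hyperbolic element with attracting end ξ₊ and repelling end ξ₋. Then G_{ξ₊}⁰ ⊆ ⟨U⁺_a, U⁻_a⟩ and G_{ξ₋}⁰ ⊆ ⟨U⁺_a, U⁻_a⟩, where G_{ξ}⁰ = {g ∈ G : g(ξ) = ξ and g fixes some vertex of T}. In particular, for every edge e in the interior of the axis of a, the pointwise edge stabilizer G_e is contained in ⟨U⁺_a, U⁻_a⟩, so ⟨U⁺_a, U⁻_a⟩ is an open subgroup of G. -/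
open Filter Topology
open scoped InnerProductSpace

namespace TreeHM

variable {V : Type}

theorem side_or (T : SimpleGraph V) (hT : T.IsTree) {u v : V} (h : T.Adj u v) (y : V) :
    y ∈ EdgeSide T u v ∨ y ∈ EdgeSide T v u := by
  have := hT.dist_eq_dist_add_one_of_adj y h
  simp only [EdgeSide, Set.mem_setOf_eq]
  rw [T.dist_comm (u := v), T.dist_comm (u := u)]
  omega

theorem dist_cross (T : SimpleGraph V) (hT : T.IsTree) {u v : V} (h : T.Adj u v) {y z : V}
    (hy : y ∈ EdgeSide T u v) (hz : z ∈ EdgeSide T v u) :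
    T.dist y z = T.dist y u + 1 + T.dist v z := by
  classical
  simp only [EdgeSide, Set.mem_setOf_eq] at hy hz
  obtain ⟨p, hp, hpl⟩ := hT.connected.exists_path_of_dist y u
  obtain ⟨q, hq, hql⟩ := hT.connected.exists_path_of_dist v z
  obtain ⟨r, hr, hrl⟩ := hT.connected.exists_path_of_dist y z
  have key : (p.append (SimpleGraph.Walk.cons h q)).IsPath := by
    rw [SimpleGraph.Walk.isPath_def, SimpleGraph.Walk.support_append,
      SimpleGraph.Walk.support_cons, List.tail_cons]
    refine List.Nodup.append hp.support_nodup hq.support_nodup ?_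
    intro w hw1 hw2
    have e1 : T.dist y w + T.dist w u ≤ p.length := by
      have := congrArg SimpleGraph.Walk.length (p.take_spec hw1)
      rw [SimpleGraph.Walk.length_append] at this
      have := SimpleGraph.dist_le (p.takeUntil w hw1)
      have := SimpleGraph.dist_le (p.dropUntil w hw1)
      omega
    have e2 : T.dist v w + T.dist w z ≤ q.length := by
      have := congrArg SimpleGraph.Walk.length (q.take_spec hw2)
      rw [SimpleGraph.Walk.length_append] at this
      have := SimpleGraph.dist_le (q.takeUntil w hw2)
      have := SimpleGraph.dist_le (q.dropUntil w hw2)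
      omega
    have t1 := hT.connected.dist_triangle (u := v) (v := w) (w := y)
    have t2 := hT.connected.dist_triangle (u := u) (v := w) (w := z)
    rw [T.dist_comm (u := w) (v := y)] at t1
    rw [T.dist_comm (u := y) (v := u)] at hpl
    rw [T.dist_comm (u := w) (v := u)] at e1
    omega
  have := hT.isAcyclic.path_unique ⟨_, key⟩ ⟨_, hr⟩
  have := congrArg (fun s : T.Path y z => s.1.length) this
  simp only [SimpleGraph.Walk.length_append, SimpleGraph.Walk.length_cons] at this
  omega

theorem geod_pt_unique (T : SimpleGraph V) (hT : T.IsTree) {x y p q : V}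
    (hp : T.dist x y = T.dist x p + T.dist p y) (hq : T.dist x y = T.dist x q + T.dist q y)
    (h : T.dist x p = T.dist x q) : p = q := by
  have key : ∀ w, T.dist x y = T.dist x w + T.dist w y →
      ∃ r : T.Path x y, r.1.getVert (T.dist x w) = w := by
    intro w hw
    obtain ⟨p1, -, h1⟩ := hT.connected.exists_path_of_dist x w
    obtain ⟨p2, -, h2⟩ := hT.connected.exists_path_of_dist w y
    refine ⟨⟨p1.append p2, ?_⟩, ?_⟩
    · apply SimpleGraph.Walk.isPath_of_length_eq_dist
      rw [SimpleGraph.Walk.length_append]; omega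
    · simp only [SimpleGraph.Walk.getVert_append, ← h1]
      simp
  obtain ⟨r, hr⟩ := key p hp
  obtain ⟨s, hs⟩ := key q hq
  rw [← hr, ← hs, h, hT.isAcyclic.path_unique r s]

/-- A vertex closer to `y` than `y` is to the edge is on the same side. -/
theorem side_of_near (T : SimpleGraph V) (hT : T.IsTree) {u v : V} (h : T.Adj u v) {y z : V}
    (hy : y ∈ EdgeSide T u v) (hd : T.dist y z ≤ T.dist y u) : z ∈ EdgeSide T u v := by
  rcases side_or T hT h z with h1 | h1
  · exact h1
  · have := dist_cross T hT h hy h1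
    omega

theorem side_map (T : SimpleGraph V) (g : T ≃g T) (u v y : V) :
    g y ∈ EdgeSide T (g u) (g v) ↔ y ∈ EdgeSide T u v := by
  simp only [EdgeSide, Set.mem_setOf_eq, iso_dist_eq]

theorem side_not_s12 (T : SimpleGraph V) {u v y : V}
    (h1 : y ∈ EdgeSide T u v) (h2 : y ∈ EdgeSide T v u) : False := by
  simp only [EdgeSide, Set.mem_setOf_eq] at h1 h2
  omega

theorem ray_side (T : SimpleGraph V) (hT : T.IsTree) (r : GeodRay T) (x : V) (m : ℕ)
    (hm : T.dist (r.seq 0) x ≤ m) : x ∈ EdgeSide T (r.seq m) (r.seq (m + 1)) := by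
  apply side_of_near T hT (r.adj m) (y := r.seq 0)
  · simp only [EdgeSide, Set.mem_setOf_eq, r.geodesic]
    simp [Nat.dist]
  · rw [r.geodesic]
    simpa [Nat.dist] using hm

theorem attr_side (T : SimpleGraph V) (hT : T.IsTree) (a : T ≃g T) (r : GeodRay T)
    (h : IsAttractingEnd T a r) (m : ℕ) (y : V) :
    ∀ᶠ n in atTop, (a ^ n) y ∈ EdgeSide T (r.seq (m + 1)) (r.seq m) := by
  filter_upwards [h m, h (m + 1), h (m + 1 + T.dist (r.seq 0) y)] with n h1 h2 h3
  apply side_of_near T hT (r.adj m).symm (y := (a ^ n) (r.seq 0))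
  · simp only [EdgeSide, Set.mem_setOf_eq]
    omega
  · rw [iso_dist_eq, T.dist_comm (v := r.seq (m + 1))]
    omega

/-- The edge `(u, v)` is coherently translated by `a`. -/
def Coh (T : SimpleGraph V) (a : T ≃g T) (u v : V) : Prop :=
  T.Adj u v ∧ a u ∈ EdgeSide T v u ∧ a v ∈ EdgeSide T v u ∧
    u ∈ EdgeSide T (a u) (a v) ∧ v ∈ EdgeSide T (a u) (a v)

theorem Coh.inv (T : SimpleGraph V) {a : T ≃g T} {u v : V} (h : Coh T a u v) :
    Coh T a⁻¹ v u := by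
  obtain ⟨h0, h1, h2, h3, h4⟩ := h
  refine ⟨h0.symm, ?_, ?_, ?_, ?_⟩
  · rw [← side_map T a]; simpa using h4
  · rw [← side_map T a]; simpa using h3
  · rw [← side_map T a]; simpa using h2
  · rw [← side_map T a]; simpa using h1

theorem coh_pos (T : SimpleGraph V) (hT : T.IsTree) {a : T ≃g T} {u v : V} (h : Coh T a u v)
    (y : V) : ∀ᶠ n in atTop, (a ^ n) y ∈ EdgeSide T v u := by
  obtain ⟨h0, h1, h2, h3, h4⟩ := h
  have step : ∀ w, w ∈ EdgeSide T v u →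
      a w ∈ EdgeSide T v u ∧ T.dist u w + 1 ≤ T.dist u (a w) := by
    intro w hw
    have c1 := dist_cross T hT (a.map_adj_iff.mpr h0) h3 ((side_map T a v u w).mpr hw)
    rw [iso_dist_eq] at c1
    have hw' := hw
    simp only [EdgeSide, Set.mem_setOf_eq] at hw'
    have h1' := h1
    simp only [EdgeSide, Set.mem_setOf_eq] at h1'
    refine ⟨?_, by omega⟩
    rcases side_or T hT h0 (a w) with h5 | h5
    · have c2 := dist_cross T hT h0 h5 h1
      rw [iso_dist_eq, T.dist_comm (u := w), T.dist_comm (u := a w)] at c2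
      omega
    · exact h5
  have it : ∀ n : ℕ, (a ^ n) v ∈ EdgeSide T v u ∧ n + 1 ≤ T.dist u ((a ^ n) v) := by
    intro n
    induction n with
    | zero =>
      have : T.dist u v = 1 := SimpleGraph.dist_eq_one_iff_adj.mpr h0
      simp [EdgeSide, this]
    | succ n ih =>
      have := step _ ih.1
      rw [pow_succ']
      refine ⟨this.1, ?_⟩
      have h2 := this.2
      have h3 := ih.2
      change n + 1 + 1 ≤ T.dist u (a ((a ^ n) v))
      omega
  filter_upwards [eventually_ge_atTop (T.dist v y)] with n hn
  apply side_of_near T hT h0.symm (it n).1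
  have := it n
  have e := this.1
  simp only [EdgeSide, Set.mem_setOf_eq] at e
  rw [iso_dist_eq, T.dist_comm (v := v)]
  omega

theorem tendsto_one (T : SimpleGraph V) (G : Subgroup (T ≃g T)) (f : ℕ → G)
    (h : ∀ y, ∀ᶠ n in atTop, (f n : T ≃g T) y = y) : Tendsto f atTop (𝓝 1) := by
  rw [tendsto_subtype_rng]
  letI : TopologicalSpace V := ⊥
  have : DiscreteTopology V := ⟨rfl⟩
  rw [nhds_induced, tendsto_comap_iff, tendsto_pi_nhds]
  intro y
  apply Tendsto.congr' _ tendsto_const_nhds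
  filter_upwards [h y] with n hn
  simpa using hn.symm

theorem coh_mem (T : SimpleGraph V) (hT : T.IsTree) (G : Subgroup (T ≃g T))
    (htits : TitsIndep T G) (a : G) {u v : V} (h : Coh T (a : T ≃g T) u v) (g : G)
    (hu : (g : T ≃g T) u = u) (hv : (g : T ≃g T) v = v) :
    g ∈ Subgroup.closure (Upos a ∪ Uneg a) := by
  obtain ⟨g1, hg1, g2, hg2, he, hf1, hf2⟩ := htits u v h.1 g g.2 hu hv
  have e : g = ⟨g1, hg1⟩ * ⟨g2, hg2⟩ := Subtype.ext he
  rw [e]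
  refine mul_mem (Subgroup.subset_closure (Or.inr ?_)) (Subgroup.subset_closure (Or.inl ?_))
  · apply tendsto_one
    intro y
    filter_upwards [coh_pos T hT h.inv y] with n hn
    have := hf1 _ hn
    rw [inv_pow] at this
    simp [this]
  · apply tendsto_one
    intro y
    filter_upwards [coh_pos T hT h y] with n hn
    have := hf2 _ hn
    simp [this]

theorem no_fix (T : SimpleGraph V) {a : T ≃g T} (ha : IsHyperbolic T a) (x : V)
    (h : a x = x) : False := by
  have : transLen T a ≤ T.dist x (a x) := Nat.sInf_le ⟨x, rfl⟩
  rw [h, SimpleGraph.dist_self] at this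
  unfold IsHyperbolic at ha
  omega

theorem ray_coh (T : SimpleGraph V) (hT : T.IsTree) (a : T ≃g T) (ha : IsHyperbolic T a)
    (r : GeodRay T) (h : IsAttractingEnd T a r) :
    ∃ K, ∀ k, K ≤ k → Coh T a (r.seq k) (r.seq (k + 1)) := by
  obtain ⟨d, hd⟩ : ∃ d, d = T.dist (r.seq 0) (a (r.seq 0)) := ⟨_, rfl⟩
  have hs : ∀ m, d ≤ m → r.seq 0 ∈ EdgeSide T (a (r.seq m)) (a (r.seq (m + 1))) := by
    intro m hm
    apply ray_side T hT (mapRay T a r)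
    change T.dist (a (r.seq 0)) (r.seq 0) ≤ m
    rw [T.dist_comm]; omega
  have hk : ∀ m, d ≤ m → a (r.seq m) = r.seq (T.dist (r.seq 0) (a (r.seq m))) := by
    intro m hm
    have e1 := attr_side T hT a r h m (r.seq 0)
    have e2 := (tendsto_add_atTop_nat 1).eventually (h (T.dist (r.seq 0) (a (r.seq m))))
    obtain ⟨n, h1, h2⟩ := (e1.and e2).exists
    have h3 := (side_map T a _ _ _).mpr h1
    have hadj : T.Adj (a (r.seq m)) (a (r.seq (m + 1))) := a.map_adj_iff.mpr (r.adj m)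
    have h4 := dist_cross T hT hadj (hs m hm) h3
    have h5 : (a ^ (n + 1)) (r.seq 0) = a ((a ^ n) (r.seq 0)) := by
      rw [pow_succ']; rfl
    simp only [h5] at h2
    have h6 := h3
    simp only [EdgeSide, Set.mem_setOf_eq] at h6
    apply geod_pt_unique T hT (x := r.seq 0) (y := a ((a ^ n) (r.seq 0)))
    · omega
    · rw [r.geodesic]; simp only [Nat.dist]; omega
    · rw [r.geodesic]; simp only [Nat.dist]; omega
  obtain ⟨K, hK⟩ : ∃ K, K = T.dist (r.seq 0) (a (r.seq d)) := ⟨_, rfl⟩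
  have hdist : ∀ j, T.dist (r.seq 0) (a (r.seq (d + j))) = K + j := by
    intro j
    induction j with
    | zero => simp [hK]
    | succ j ih =>
      have := hs (d + j) (by omega)
      simp only [EdgeSide, Set.mem_setOf_eq] at this
      rw [T.dist_comm (v := r.seq 0), T.dist_comm (v := r.seq 0)] at this
      rw [← add_assoc, this, ih]; omega
  have hshift : ∀ j, a (r.seq (d + j)) = r.seq (K + j) := by
    intro j
    rw [hk _ (by omega), hdist]
  rcases lt_trichotomy K d with hlt | heq | hgt
  · exfalso
    obtain ⟨e, rfl⟩ := Nat.exists_eq_add_of_lt hlt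
    have hpow : ∀ n i, (a ^ n) (r.seq (K + n * (e + 1) + i)) = r.seq (K + i) := by
      intro n
      induction n with
      | zero => intro i; simp
      | succ n ih =>
        intro i
        rw [pow_succ]
        change (a ^ n) (a _) = _
        have := hshift (n * (e + 1) + i)
        rw [show K + (n + 1) * (e + 1) + i = K + e + 1 + (n * (e + 1) + i) by ring, this,
          ← add_assoc, ih]
    obtain ⟨n, hn⟩ := (attr_side T hT a r h K (r.seq 0)).exists
    have h1 := hpow n 0
    have h2 := hpow n 1
    have h3 := ray_side T hT r (r.seq 0) (K + n * (e + 1)) (by simp)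
    rw [← side_map T (a ^ n), h2] at h3
    rw [add_zero, add_zero] at h1
    rw [h1] at h3
    exact side_not_s12 T h3 hn
  · exfalso
    have := hshift 0
    rw [heq] at this
    exact no_fix T ha _ this
  · obtain ⟨c, rfl⟩ := Nat.exists_eq_add_of_lt hgt
    refine ⟨d, fun k hk => ?_⟩
    obtain ⟨j, rfl⟩ := Nat.exists_eq_add_of_le hk
    have e1 := hshift j
    have e2 := hshift (j + 1)
    rw [← add_assoc] at e2
    refine ⟨r.adj _, ?_, ?_, ?_, ?_⟩ <;>
      simp only [EdgeSide, Set.mem_setOf_eq, e1, e2, r.geodesic, Nat.dist] <;> omega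

theorem min_coh (T : SimpleGraph V) (hT : T.IsTree) (a : T ≃g T) (ha : IsHyperbolic T a)
    (r : GeodRay T) (h : IsAttractingEnd T a r) {u v : V} (huv : T.Adj u v)
    (hu : u ∈ MinSet T a) (hv : v ∈ MinSet T a) : Coh T a u v ∨ Coh T a v u := by
  have noinv : ∀ x y, a x = y → a y = x → False := by
    intro x y hx hy
    obtain ⟨K, hK⟩ := ray_coh T hT a ha r h
    have h1 := attr_side T hT a r h (T.dist (r.seq 0) x) x
    have h2 := ray_side T hT r x _ le_rfl
    obtain ⟨N, hN⟩ := eventually_atTop.mp h1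
    have h3 := hN (2 * N) (by omega)
    have h4 : ∀ n : ℕ, (a ^ (2 * n)) x = x := by
      intro n
      induction n with
      | zero => simp
      | succ n ih =>
        rw [show 2 * (n + 1) = 2 * n + 1 + 1 by ring, pow_succ, pow_succ]
        change (a ^ (2 * n)) (a (a x)) = x
        rw [hx, hy, ih]
    rw [h4] at h3
    exact side_not_s12 T h2 h3
  have key : ∀ u v, T.Adj u v → u ∈ MinSet T a → v ∈ MinSet T a → a u ∈ EdgeSide T v u →
      Coh T a u v := by
    intro u v huv hu hv h1
    simp only [MinSet, Set.mem_setOf_eq] at hu hv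
    have hadj : T.Adj (a u) (a v) := a.map_adj_iff.mpr huv
    have d1 : T.dist (a u) (a v) = 1 := SimpleGraph.dist_eq_one_iff_adj.mpr hadj
    have d2 : T.dist u v = 1 := SimpleGraph.dist_eq_one_iff_adj.mpr huv
    have h1' := h1
    simp only [EdgeSide, Set.mem_setOf_eq] at h1'
    have h2 : a v ∈ EdgeSide T v u := by
      rcases side_or T hT huv (a v) with h5 | h5
      · exfalso
        have := dist_cross T hT huv h5 h1
        rw [T.dist_comm, d1] at this
        apply noinv u v
        · exact ((hT.connected.dist_eq_zero_iff).mp (by omega : T.dist v (a u) = 0)).symm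
        · exact (hT.connected.dist_eq_zero_iff).mp (by omega)
      · exact h5
    have h4 : v ∈ EdgeSide T (a u) (a v) := by
      simp only [EdgeSide, Set.mem_setOf_eq]
      rw [T.dist_comm (v := v), T.dist_comm (v := v)]
      omega
    have h3 : u ∈ EdgeSide T (a u) (a v) := by
      simp only [EdgeSide, Set.mem_setOf_eq] at h2 ⊢
      rw [T.dist_comm (v := u), T.dist_comm (v := u)]
      omega
    exact ⟨huv, h1, h2, h3, h4⟩
  rcases side_or T hT huv (a u) with h1 | h1
  · right
    apply key v u huv.symm hv hu
    rcases side_or T hT huv (a v) with h2 | h2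
    · exact h2
    · exfalso
      have := dist_cross T hT huv h1 h2
      have d1 : T.dist (a u) (a v) = 1 :=
        SimpleGraph.dist_eq_one_iff_adj.mpr (a.map_adj_iff.mpr huv)
      exact no_fix T ha u ((hT.connected.dist_eq_zero_iff).mp (by omega))
  · left
    exact key u v huv hu hv h1

theorem endStab_fix (T : SimpleGraph V) (hT : T.IsTree) (g : T ≃g T) (r : GeodRay T)
    (h : FixesEnd T g r) (x : V) (hx : g x = x) : ∃ K, ∀ k, K ≤ k → g (r.seq k) = r.seq k := by
  obtain ⟨k, l, hkl⟩ := h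
  have hkl' : ∀ n, g (r.seq (k + n)) = r.seq (l + n) := hkl
  obtain ⟨D, hD⟩ : ∃ D, D = T.dist (r.seq 0) x := ⟨_, rfl⟩
  have hd : ∀ n, T.dist x (r.seq (D + n)) = T.dist x (r.seq D) + n := by
    intro n
    induction n with
    | zero => rfl
    | succ n ih =>
      have := ray_side T hT r x (D + n) (by omega)
      simp only [EdgeSide, Set.mem_setOf_eq] at this
      rw [T.dist_comm (v := x), T.dist_comm (u := r.seq (D + n))] at this
      rw [← add_assoc, this, ih]; omega
  have e := iso_dist_eq T g x (r.seq (k + D))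
  rw [hx, hkl', add_comm l, add_comm k, hd, hd] at e
  have : k = l := by omega
  subst this
  refine ⟨k, fun j hj => ?_⟩
  obtain ⟨i, rfl⟩ := Nat.exists_eq_add_of_le hj
  exact hkl' i

theorem endStab_mem (T : SimpleGraph V) (hT : T.IsTree) (G : Subgroup (T ≃g T))
    (htits : TitsIndep T G) (a : G) (ha : IsHyperbolic T (a : T ≃g T)) (r : GeodRay T)
    (h : IsAttractingEnd T (a : T ≃g T) r) :
    EndStab0 T G r ⊆ (Subgroup.closure (Upos a ∪ Uneg a) : Subgroup G) := by
  rintro g ⟨hg, x, hx⟩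
  obtain ⟨K, hK⟩ := ray_coh T hT a ha r h
  obtain ⟨L, hL⟩ := endStab_fix T hT g r hg x hx
  exact coh_mem T hT G htits a (hK (K + L) (by omega)) g (hL _ (by omega)) (hL _ (by omega))

theorem hyp_inv (T : SimpleGraph V) {a : T ≃g T} (ha : IsHyperbolic T a) :
    IsHyperbolic T a⁻¹ := by
  have : transLen T a⁻¹ = transLen T a := by
    unfold transLen
    congr 1
    ext n
    constructor
    · rintro ⟨x, rfl⟩
      refine ⟨a⁻¹ x, ?_⟩
      simp [T.dist_comm]
    · rintro ⟨x, rfl⟩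
      refine ⟨a x, ?_⟩
      simp [T.dist_comm]
  unfold IsHyperbolic
  rw [this]; exact ha

theorem isOpen_fix2 (T : SimpleGraph V) (G : Subgroup (T ≃g T)) (u p : V) :
    IsOpen {g : G | (g : T ≃g T) u = p} := by
  letI : TopologicalSpace V := ⊥
  have : DiscreteTopology V := ⟨rfl⟩
  have h1 : Continuous (fun (g : T ≃g T) (x : V) => g x) := continuous_induced_dom
  have h2 : Continuous (fun g : G => (g : T ≃g T) u) :=
    ((continuous_apply u).comp h1).comp continuous_subtype_val
  exact (isOpen_discrete {p}).preimage h2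

/-- Let `G ≤ Aut(T)` be a closed subgroup with Tits' independence
property, and `a ∈ G` hyperbolic with attracting end `ξ₊` and repelling end `ξ₋`.  Then
`G_{ξ₊}⁰ ⊆ ⟨U⁺_a, U⁻_a⟩` and `G_{ξ₋}⁰ ⊆ ⟨U⁺_a, U⁻_a⟩`; in particular the pointwise
stabilizer of every edge of the axis of `a` is contained in `⟨U⁺_a, U⁻_a⟩`, which is an
open subgroup of `G`. -/
theorem end_stabilizers_subset_contraction_closure
    {V : Type} (T : SimpleGraph V) (hT : T.IsTree) (hlf : LocFin T)
    (G : Subgroup (T ≃g T)) (hclosed : IsClosed (G : Set (T ≃g T)))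
    (htits : TitsIndep T G)
    (a : G) (ha : IsHyperbolic T (a : T ≃g T))
    (ξp : GeodRay T) (hξp : IsAttractingEnd T (a : T ≃g T) ξp)
    (ξm : GeodRay T) (hξm : IsAttractingEnd T ((a : T ≃g T))⁻¹ ξm) :
    EndStab0 T G ξp ⊆ (Subgroup.closure (Upos a ∪ Uneg a) : Subgroup G) ∧
    EndStab0 T G ξm ⊆ (Subgroup.closure (Upos a ∪ Uneg a) : Subgroup G) ∧
    (∀ u v : V, T.Adj u v →
      u ∈ MinSet T (a : T ≃g T) → v ∈ MinSet T (a : T ≃g T) →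
      ∀ g : G, (g : T ≃g T) u = u → (g : T ≃g T) v = v →
        g ∈ Subgroup.closure (Upos a ∪ Uneg a)) ∧
    IsOpen ((Subgroup.closure (Upos a ∪ Uneg a) : Subgroup G) : Set G) := by
  have hinv : Upos a⁻¹ ∪ Uneg a⁻¹ = Upos a ∪ Uneg a := by
    rw [Set.union_comm]
    simp [Upos, Uneg]
  refine ⟨endStab_mem T hT G htits a ha ξp hξp, ?_, ?_, ?_⟩
  · have := endStab_mem T hT G htits a⁻¹ (by simpa using hyp_inv T ha) ξm (by simpa using hξm)
    rwa [hinv] at this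
  · intro u v huv hu hv g hgu hgv
    rcases min_coh T hT a ha ξp hξp huv hu hv with h | h
    · exact coh_mem T hT G htits a h g hgu hgv
    · exact coh_mem T hT G htits a h g hgv hgu
  · obtain ⟨K, hK⟩ := ray_coh T hT a ha ξp hξp
    rw [isOpen_iff_mem_nhds]
    intro h hh
    have o := (isOpen_fix2 T G (ξp.seq K) ((h : T ≃g T) (ξp.seq K))).inter
      (isOpen_fix2 T G (ξp.seq (K + 1)) ((h : T ≃g T) (ξp.seq (K + 1))))
    refine Filter.mem_of_superset (o.mem_nhds ⟨rfl, rfl⟩) ?_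
    rintro g ⟨h1, h2⟩
    simp only [Set.mem_setOf_eq] at h1 h2
    have : h⁻¹ * g ∈ Subgroup.closure (Upos a ∪ Uneg a) := by
      apply coh_mem T hT G htits a (hK K le_rfl)
      · simp [h1]
      · simp [h2]
    have := mul_mem hh this
    simpa using this

end TreeHM
end
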